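/- Let c > 0 be a real number. The sequence (Ω(n)^c)_{n∈ℕ} is uniformly distributed mod 1 if and only if c > 1/2 and c is not an integer. -/

import Mathlib

open Filter Finset

/-- Discrete derivative: `ΔW(N) = W(N) - W(N-1)` for `N ≥ 2`, and `ΔW(1) = W(1)`. -/
noncomputable def dd (W : ℕ → ℝ) (N : ℕ) : ℝ := if 2 ≤ N then W N - W (N - 1) else W 1

/-- Weighted average `E^W_{n ≤ N} f(n) = (1/W(N)) ∑_{n=1}^N ΔW(n) f(n)`. -/
noncomputable def wAvg (W : ℕ → ℝ) (f : ℕ → ℂ) (N : ℕ) : ℂ :=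
  (1 / (W N : ℂ)) * ∑ n ∈ Finset.Icc 1 N, (dd W n : ℂ) * f n

/-- Cesàro average `E_{n ≤ N} f(n) = (1/N) ∑_{n=1}^N f(n)`. -/
noncomputable def cesaro (f : ℕ → ℂ) (N : ℕ) : ℂ :=
  (1 / (N : ℂ)) * ∑ n ∈ Finset.Icc 1 N, f n

/-- Parity-neutral binomial mean. -/
noncomputable def e2bin (f : ℕ → ℂ) (N : ℕ) : ℂ :=
  (1 / 2 ^ (N + 1) : ℂ) * ∑ n ∈ Finset.Icc 1 (2 * N), (Nat.choose N (n / 2) : ℂ) * f n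

/-- Binomial mean. -/
noncomputable def ebin (f : ℕ → ℂ) (N : ℕ) : ℂ :=
  (1 / 2 ^ N : ℂ) * ∑ n ∈ Finset.Icc 1 N, (Nat.choose N n : ℂ) * f n

/-- The class 𝒲: eventually non-decreasing nonnegative functions tending to ∞. -/
def memW (W : ℕ → ℝ) : Prop :=
  (∀ n, 0 ≤ W n) ∧ (∃ N₀ : ℕ, ∀ m n : ℕ, N₀ ≤ m → m ≤ n → W m ≤ W n) ∧
    Tendsto W atTop atTop

/-- The class 𝒲*: members of 𝒲 for which `N·Δ²W(N)/ΔW(N)` converges in `ℝ ∪ {±∞}`. -/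
def memWstar (W : ℕ → ℝ) : Prop :=
  memW W ∧ ∃ l : EReal,
    Tendsto (fun N : ℕ => (((N : ℝ) * dd (dd W) N / dd W N : ℝ) : EReal)) atTop (nhds l)

/-- The class ℒ: members of 𝒲 (with values in ℕ) whose discrete derivative is
eventually in {0,1}. -/
def memL (L : ℕ → ℕ) : Prop :=
  memW (fun n => (L n : ℝ)) ∧
    ∃ N₀ : ℕ, ∀ n : ℕ, N₀ ≤ n → L n = L (n - 1) ∨ L n = L (n - 1) + 1

/-- Gaussian probability density with mean μ and standard deviation σ. -/
noncomputable def gauss (x μ σ : ℝ) : ℝ :=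
  (1 / (σ * Real.sqrt (2 * Real.pi))) * Real.exp (-(x - μ) ^ 2 / (2 * σ ^ 2))

/-- The Gaussian condition \eqref{gaussian_condition}. -/
def gaussCond (ϑ : ℕ → ℕ) (L : ℕ → ℕ) : Prop :=
  Tendsto (fun N : ℕ => ∑' k : ℕ,
      |(((Finset.Icc 1 N).filter (fun n => ϑ n = k + 1)).card : ℝ) / N -
        gauss (k + 1 : ℝ) (L N) (Real.sqrt (L N))|) atTop (nhds 0)

/-- Ω(n): number of prime factors with multiplicity. -/
def bigOmega (n : ℕ) : ℕ := n.primeFactorsList.length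

/-- ω(n): number of distinct prime factors. -/
def smallOmega (n : ℕ) : ℕ := n.primeFactors.card

/-- Uniform distribution mod 1. -/
def udMod1 (x : ℕ → ℝ) : Prop :=
  ∀ a b : ℝ, 0 ≤ a → a < b → b ≤ 1 →
    Tendsto (fun N : ℕ =>
        (((Finset.Icc 1 N).filter
            (fun n => a ≤ Int.fract (x n) ∧ Int.fract (x n) < b)).card : ℝ) / N)
      atTop (nhds (b - a))

open MeasureTheory Complex in
theorem integral_fejer (v : ℝ) :
    ∫ t in (-1 : ℝ)..1, ((1 - |t| : ℝ) : ℂ) * cexp (I * t * v) = ((Real.sinc (v / 2) ^ 2 : ℝ) : ℂ) := by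
  have hcont : Continuous fun t : ℝ => ((1 - |t| : ℝ) : ℂ) * cexp (I * t * v) := by fun_prop
  rcases eq_or_ne v 0 with rfl | hv
  · have h1 : ∫ t in (-1 : ℝ)..1, (1 - |t|) = 1 := by
      have hc : Continuous fun t : ℝ => (1 - |t|) := by fun_prop
      rw [← intervalIntegral.integral_add_adjacent_intervals (b := 0)
        (hc.intervalIntegrable _ _) (hc.intervalIntegrable _ _)]
      have e1 : ∫ t in (-1 : ℝ)..0, (1 - |t|) = ∫ t in (-1 : ℝ)..0, (1 + t) := by
        apply intervalIntegral.integral_congr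
        intro t ht
        rw [Set.uIcc_of_le (by norm_num)] at ht
        simp only [abs_of_nonpos ht.2]; ring
      have e2 : ∫ t in (0 : ℝ)..1, (1 - |t|) = ∫ t in (0 : ℝ)..1, (1 - t) := by
        apply intervalIntegral.integral_congr
        intro t ht
        rw [Set.uIcc_of_le (by norm_num)] at ht
        simp only [abs_of_nonneg ht.1]
      rw [e1, e2, intervalIntegral.integral_add (by simp) (by simp),
        intervalIntegral.integral_sub (by simp) (by simp)]
      norm_num
    simp only [ofReal_zero, mul_zero, Complex.exp_zero, mul_one]
    rw [intervalIntegral.integral_ofReal, h1]; simp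
  · have hv' : (v : ℂ) ≠ 0 := by exact_mod_cast hv
    rw [← intervalIntegral.integral_add_adjacent_intervals (b := 0)
        (hcont.intervalIntegrable _ _) (hcont.intervalIntegrable _ _)]
    have hexp : ∀ t : ℝ, HasDerivAt (fun t : ℝ => cexp (I * t * v)) (cexp (I * t * v) * (I * v)) t := by
      intro t
      have : HasDerivAt (fun t : ℝ => I * (t : ℂ) * v) (I * 1 * v) t :=
        ((hasDerivAt_id t).ofReal_comp.const_mul I).mul_const _
      simpa using this.cexp
    have hid : ∀ t : ℝ, HasDerivAt (fun t : ℝ => (t : ℂ)) 1 t := fun t => (hasDerivAt_id t).ofReal_comp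
    have e1 : ∫ t in (-1 : ℝ)..0, ((1 - |t| : ℝ) : ℂ) * cexp (I * t * v) =
        ∫ t in (-1 : ℝ)..0, (1 + (t : ℂ)) * cexp (I * t * v) := by
      apply intervalIntegral.integral_congr
      intro t ht
      rw [Set.uIcc_of_le (by norm_num)] at ht
      simp only [abs_of_nonpos ht.2]; push_cast; ring
    have e2 : ∫ t in (0 : ℝ)..1, ((1 - |t| : ℝ) : ℂ) * cexp (I * t * v) =
        ∫ t in (0 : ℝ)..1, (1 - (t : ℂ)) * cexp (I * t * v) := by
      apply intervalIntegral.integral_congr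
      intro t ht
      rw [Set.uIcc_of_le (by norm_num)] at ht
      simp only [abs_of_nonneg ht.1]; push_cast; ring
    rw [e1, e2, intervalIntegral.integral_eq_sub_of_hasDerivAt
      (f := fun t : ℝ => (1 + (t : ℂ)) * cexp (I * t * v) / (I * v) - cexp (I * t * v) / (I * v) ^ 2),
      intervalIntegral.integral_eq_sub_of_hasDerivAt
      (f := fun t : ℝ => (1 - (t : ℂ)) * cexp (I * t * v) / (I * v) + cexp (I * t * v) / (I * v) ^ 2)]
    · rw [Real.sinc_of_ne_zero (by positivity)]
      have h2 : cexp (I * v) + cexp (-(I * v)) = 2 * Complex.cos v := by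
        rw [Complex.cos]; ring_nf
      have h3 : Complex.cos v = 1 - 2 * (Complex.sin (v / 2)) ^ 2 := by
        have := Complex.cos_two_mul ((v : ℂ) / 2)
        have h4 := Complex.sin_sq_add_cos_sq ((v : ℂ) / 2)
        rw [show (2 : ℂ) * (v / 2) = v by ring] at this
        rw [this]; linear_combination 2 * h4
      push_cast
      have h5 : cexp (I * 1 * v) = cexp (I * v) := by ring_nf
      have h6 : cexp (I * (-1) * v) = cexp (-(I * v)) := by ring_nf
      have h7 : cexp (I * 0 * v) = 1 := by simp
      rw [h5, h6, h7]
      field_simp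
      rw [I_sq]
      linear_combination h2 + 2 * h3
    · intro t _
      refine HasDerivAt.congr_deriv (((((hid t).const_sub 1).mul (hexp t)).div_const (I * v)).add
        ((hexp t).div_const ((I * v) ^ 2))) ?_
      field_simp
      ring
    · apply Continuous.intervalIntegrable; fun_prop
    · intro t _
      refine HasDerivAt.congr_deriv (((((hid t).const_add 1).mul (hexp t)).div_const (I * v)).sub
        ((hexp t).div_const ((I * v) ^ 2))) ?_
      field_simp
      ring
    · apply Continuous.intervalIntegrable; fun_prop

theorem sinc_half_sq_le (v : ℝ) : Real.sinc (v / 2) ^ 2 ≤ 5 * (1 + v ^ 2)⁻¹ := by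
  rw [← div_eq_mul_inv, le_div_iff₀ (by positivity)]
  have h1 : Real.sinc (v / 2) ^ 2 ≤ 1 := by
    rw [sq_le_one_iff_abs_le_one]; exact Real.abs_sinc_le_one _
  have h2 : Real.sinc (v / 2) ^ 2 * v ^ 2 ≤ 4 := by
    rcases eq_or_ne v 0 with rfl | hv
    · norm_num
    · rw [Real.sinc_of_ne_zero (by positivity)]
      have := Real.sin_sq_le_one (v / 2)
      field_simp
      nlinarith
  linarith

open MeasureTheory in
theorem integrable_sinc_half_sq : Integrable fun v : ℝ => Real.sinc (v / 2) ^ 2 := by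
  refine (integrable_inv_one_add_sq.const_mul 5).mono' ?_ ?_
  · exact (Real.continuous_sinc.comp (by fun_prop : Continuous fun v : ℝ => v / 2)).pow 2
      |>.aestronglyMeasurable
  · refine ae_of_all _ fun v => ?_
    rw [Real.norm_of_nonneg (by positivity)]
    exact sinc_half_sq_le v

section
open MeasureTheory Complex

theorem fejer_conv_eq {b : ℝ → ℝ} (hb : Measurable b) {C : ℝ} (hC : ∀ u, |b u| ≤ C) {G : ℂ → ℂ}
    (h : ∀ z : ℂ, 0 < z.re → ∫ u in Set.Ioi (0 : ℝ), (b u : ℂ) * cexp (-z * u) = G z)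
    (l y : ℝ) {δ : ℝ} (hδ : 0 < δ) :
    ∫ t in (-1 : ℝ)..1, ((1 - |t| : ℝ) : ℂ) * cexp (I * t * (l * y)) * G (δ + I * (l * t)) =
      ∫ u in Set.Ioi (0 : ℝ), (b u : ℂ) * cexp (-δ * u) *
        ((Real.sinc (l * (y - u) / 2) ^ 2 : ℝ) : ℂ) := by
  have hCexp : IntegrableOn (fun u : ℝ => C * Real.exp (-δ * u)) (Set.Ioi 0) :=
    (integrableOn_exp_mul_Ioi (by linarith) 0).const_mul C
  have hphi : IntegrableOn (fun t : ℝ => |(1 - |t|)|) (Set.Ioc (-1) 1) := by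
    apply Continuous.integrableOn_Ioc; fun_prop
  have hnorm : ∀ t u : ℝ, ‖cexp (-(δ + I * (l * t)) * u)‖ = Real.exp (-δ * u) := by
    intro t u
    rw [Complex.norm_exp]; simp
  calc
    _ = ∫ t in Set.Ioc (-1 : ℝ) 1, ∫ u in Set.Ioi (0 : ℝ),
        ((1 - |t| : ℝ) : ℂ) * cexp (I * t * (l * y)) *
          ((b u : ℂ) * cexp (-(δ + I * (l * t)) * u)) := by
      rw [intervalIntegral.integral_of_le (by norm_num)]
      congr 1 with t
      rw [integral_const_mul, h _ (by simpa using hδ)]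
    _ = ∫ u in Set.Ioi (0 : ℝ), ∫ t in Set.Ioc (-1 : ℝ) 1,
        ((1 - |t| : ℝ) : ℂ) * cexp (I * t * (l * y)) *
          ((b u : ℂ) * cexp (-(δ + I * (l * t)) * u)) := by
      apply integral_integral_swap
      refine (Integrable.mul_prod hphi hCexp).mono' ?_ ?_
      · apply Measurable.aestronglyMeasurable
        unfold Function.uncurry
        fun_prop
      · refine ae_of_all _ fun p => ?_
        simp only [Function.uncurry, norm_mul, hnorm, Complex.norm_real, Real.norm_eq_abs]
        have e1 : ‖cexp (I * p.1 * (l * y))‖ = 1 := by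
          rw [Complex.norm_exp]; simp
        rw [e1, mul_one]
        have := hC p.2
        gcongr
    _ = _ := by
      congr 1 with u
      rw [show l * (y - u) / 2 = (l * (y - u)) / 2 by ring, ← integral_fejer (l * (y - u)),
        intervalIntegral.integral_of_le (by norm_num), ← integral_const_mul]
      congr 1 with t
      have : cexp (I * t * (l * y)) * cexp (-(δ + I * (l * t)) * u) =
          cexp (-δ * u) * cexp (I * t * ((l * (y - u) : ℝ) : ℂ)) := by
        rw [← Complex.exp_add, ← Complex.exp_add]; congr 1; push_cast; ring
      linear_combination (((1 - |t| : ℝ) : ℂ) * (b u : ℂ)) * this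

theorem integrable_sinc_sq_comp {l : ℝ} (hl : l ≠ 0) (y : ℝ) :
    Integrable fun u : ℝ => Real.sinc (l * (y - u) / 2) ^ 2 :=
  (integrable_sinc_half_sq.comp_mul_left' hl).comp_sub_left y

theorem fejer_conv_eq_boundary {b : ℝ → ℝ} (hb : Measurable b) {C : ℝ} (hC : ∀ u, |b u| ≤ C)
    {G : ℂ → ℂ} (hG : ContinuousOn G {z | 0 ≤ z.re})
    (h : ∀ z : ℂ, 0 < z.re → ∫ u in Set.Ioi (0 : ℝ), (b u : ℂ) * cexp (-z * u) = G z)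
    {l : ℝ} (hl : l ≠ 0) (y : ℝ) :
    ∫ t in (-1 : ℝ)..1, ((1 - |t| : ℝ) : ℂ) * cexp (I * t * (l * y)) * G (I * (l * t)) =
      ∫ u in Set.Ioi (0 : ℝ), (b u : ℂ) * ((Real.sinc (l * (y - u) / 2) ^ 2 : ℝ) : ℂ) := by
  have hC0 : 0 ≤ C := (abs_nonneg _).trans (hC 0)
  let K : Set (ℝ × ℝ) := Set.Icc 0 1 ×ˢ Set.Icc (-1) 1
  have hK : IsCompact K := isCompact_Icc.prod isCompact_Icc
  have hGc : ContinuousOn (fun p : ℝ × ℝ => G (p.1 + I * (l * p.2))) K := by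
    apply hG.comp (by fun_prop)
    rintro ⟨a, c⟩ ⟨ha, _⟩
    simpa using ha.1
  obtain ⟨M, hM⟩ := hK.exists_bound_of_continuousOn hGc
  have hGt : ∀ δ ∈ Set.Icc (0 : ℝ) 1,
      ContinuousOn (fun t : ℝ => G (δ + I * (l * t))) (Set.Icc (-1) 1) := by
    intro δ hδ
    exact hGc.comp (f := fun t : ℝ => (δ, t)) (by fun_prop) fun t ht => ⟨hδ, ht⟩
  have hev : ∀ᶠ δ : ℝ in nhdsWithin 0 (Set.Ioi 0), δ ∈ Set.Ioc (0 : ℝ) 1 :=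
    Ioc_mem_nhdsGT (by norm_num)
  have hL : Tendsto (fun δ : ℝ => ∫ t in (-1 : ℝ)..1,
      ((1 - |t| : ℝ) : ℂ) * cexp (I * t * (l * y)) * G (δ + I * (l * t)))
      (nhdsWithin 0 (Set.Ioi 0)) (nhds (∫ t in (-1 : ℝ)..1,
      ((1 - |t| : ℝ) : ℂ) * cexp (I * t * (l * y)) * G (I * (l * t)))) := by
    simp only [intervalIntegral.integral_of_le (show (-1 : ℝ) ≤ 1 by norm_num)]
    apply tendsto_integral_filter_of_dominated_convergence (bound := fun t => |(1 - |t|)| * M)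
    · filter_upwards [hev] with δ hδ
      apply ContinuousOn.aestronglyMeasurable _ measurableSet_Ioc
      apply ContinuousOn.mul (by fun_prop)
      exact (hGt δ ⟨hδ.1.le, hδ.2⟩).mono Set.Ioc_subset_Icc_self
    · filter_upwards [hev] with δ hδ
      refine (ae_restrict_iff' measurableSet_Ioc).2 (ae_of_all _ fun t ht => ?_)
      have e1 : ‖cexp (I * t * (l * y))‖ = 1 := by
        rw [Complex.norm_exp]; simp
      rw [norm_mul, norm_mul, e1, mul_one, Complex.norm_real, Real.norm_eq_abs]
      gcongr
      exact hM (δ, t) ⟨⟨hδ.1.le, hδ.2⟩, ht.1.le, ht.2⟩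
    · apply Continuous.integrableOn_Ioc; fun_prop
    · refine (ae_restrict_iff' measurableSet_Ioc).2 (ae_of_all _ fun t ht => ?_)
      apply Tendsto.const_mul
      have h0 : ContinuousWithinAt (fun p : ℝ × ℝ => G (p.1 + I * (l * p.2))) K (0, t) :=
        hGc (0, t) ⟨⟨le_rfl, zero_le_one⟩, ht.1.le, ht.2⟩
      have h1 : Tendsto (fun δ : ℝ => (δ, t)) (nhdsWithin 0 (Set.Ioi 0)) (nhdsWithin (0, t) K) := by
        apply tendsto_nhdsWithin_iff.2 ⟨?_, ?_⟩
        · exact (Continuous.tendsto (by fun_prop) (0 : ℝ)).mono_left nhdsWithin_le_nhds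
        · filter_upwards [hev] with δ hδ
          exact ⟨⟨hδ.1.le, hδ.2⟩, ht.1.le, ht.2⟩
      simpa [Function.comp_def] using h0.tendsto.comp h1
  have hR : Tendsto (fun δ : ℝ => ∫ u in Set.Ioi (0 : ℝ), (b u : ℂ) * cexp (-δ * u) *
        ((Real.sinc (l * (y - u) / 2) ^ 2 : ℝ) : ℂ)) (nhdsWithin 0 (Set.Ioi 0))
      (nhds (∫ u in Set.Ioi (0 : ℝ), (b u : ℂ) * ((Real.sinc (l * (y - u) / 2) ^ 2 : ℝ) : ℂ))) := by
    apply tendsto_integral_filter_of_dominated_convergence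
      (bound := fun u => C * Real.sinc (l * (y - u) / 2) ^ 2)
    · refine Eventually.of_forall fun δ => Measurable.aestronglyMeasurable ?_
      have := Real.continuous_sinc.measurable
      fun_prop
    · filter_upwards [hev] with δ hδ
      refine (ae_restrict_iff' measurableSet_Ioi).2 (ae_of_all _ fun u hu => ?_)
      have e1 : ‖cexp (-δ * u)‖ ≤ 1 := by
        rw [Complex.norm_exp]
        have : (-(δ : ℂ) * u).re = -(δ * u) := by simp
        rw [this, Real.exp_le_one_iff]
        have := mul_nonneg hδ.1.le (le_of_lt hu)
        linarith
      rw [norm_mul, norm_mul, Complex.norm_real, Complex.norm_real, Real.norm_eq_abs,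
        Real.norm_of_nonneg (by positivity)]
      have := hC u
      gcongr
      calc |b u| * ‖cexp (-δ * u)‖ ≤ C * 1 := by gcongr
        _ = C := mul_one C
    · exact ((integrable_sinc_sq_comp hl y).const_mul C).integrableOn
    · refine ae_of_all _ fun u => ?_
      have : Tendsto (fun δ : ℝ => (b u : ℂ) * cexp (-δ * u) *
        ((Real.sinc (l * (y - u) / 2) ^ 2 : ℝ) : ℂ)) (nhds 0) (nhds ((b u : ℂ) * cexp (-(0 : ℝ) * u) *
        ((Real.sinc (l * (y - u) / 2) ^ 2 : ℝ) : ℂ))) := by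
        apply Continuous.tendsto; fun_prop
      simpa using this.mono_left nhdsWithin_le_nhds
  refine tendsto_nhds_unique hL (hR.congr' ?_)
  filter_upwards [hev] with δ hδ
  exact (fejer_conv_eq hb hC h l y hδ.1).symm

theorem tendsto_fejer_conv {b : ℝ → ℝ} (hb : Measurable b) {C : ℝ} (hC : ∀ u, |b u| ≤ C)
    {G : ℂ → ℂ} (hG : ContinuousOn G {z | 0 ≤ z.re})
    (h : ∀ z : ℂ, 0 < z.re → ∫ u in Set.Ioi (0 : ℝ), (b u : ℂ) * cexp (-z * u) = G z)
    {l : ℝ} (hl : 0 < l) :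
    Tendsto (fun y : ℝ => ∫ u in Set.Ioi (0 : ℝ), b u * Real.sinc (l * (y - u) / 2) ^ 2)
      atTop (nhds 0) := by
  let f : ℝ → ℂ := (Set.Ioc (-1 : ℝ) 1).indicator fun t => ((1 - |t| : ℝ) : ℂ) * G (I * (l * t))
  have hRL := Real.tendsto_integral_exp_smul_cocompact f
  have hy : Tendsto (fun y : ℝ => -(l * y / (2 * Real.pi))) atTop (cocompact ℝ) := by
    refine Tendsto.mono_right ?_ atBot_le_cocompact
    refine tendsto_neg_atTop_atBot.comp ?_
    exact (tendsto_id.const_mul_atTop hl).atTop_div_const (by positivity)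
  have key := hRL.comp hy
  refine ((Complex.continuous_re.tendsto _).comp key).congr fun y => ?_
  rw [← Complex.ofReal_re (∫ u in Set.Ioi (0 : ℝ), b u * Real.sinc (l * (y - u) / 2) ^ 2)]
  refine congrArg Complex.re ?_
  have := fejer_conv_eq_boundary hb hC hG h hl.ne' y
  simp only [Function.comp]
  rw [← integral_complex_ofReal]
  simp only [Complex.ofReal_mul]
  refine Eq.trans ?_ this
  rw [intervalIntegral.integral_of_le (by norm_num), ← integral_indicator measurableSet_Ioc]
  congr 1 with t
  by_cases ht : t ∈ Set.Ioc (-1 : ℝ) 1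
  · simp only [f, Set.indicator_of_mem ht]
    rw [Circle.smul_def, Real.fourierChar_apply, smul_eq_mul]
    have : ((2 * Real.pi * -(t * -(l * y / (2 * Real.pi))) : ℝ) : ℂ) * I = I * t * (l * y) := by
      have : (Real.pi : ℂ) ≠ 0 := by exact_mod_cast Real.pi_ne_zero
      push_cast
      field_simp
    rw [this]; ring
  · simp [f, Set.indicator_of_notMem ht]
end

section
open MeasureTheory Complex

theorem psi_isBigO : (fun n : ℕ => ∑ k ∈ Finset.Icc 1 n, ArithmeticFunction.vonMangoldt k)
    =O[atTop] fun n => (n : ℝ) ^ (1 : ℝ) := by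
  refine Asymptotics.IsBigO.of_bound (Real.log 4 + 4) (Eventually.of_forall fun n => ?_)
  have h := Chebyshev.psi_le_const_mul_self (Nat.cast_nonneg n)
  have h0 := Chebyshev.psi_nonneg (n : ℝ)
  have e : ∑ k ∈ Finset.Icc 1 n, ArithmeticFunction.vonMangoldt k = Chebyshev.psi n := by
    rw [Chebyshev.psi, Nat.floor_natCast]; rfl
  rw [e, Real.rpow_one, Real.norm_of_nonneg h0, Real.norm_of_nonneg (by positivity)]
  exact h

theorem laplace_psi {z : ℂ} (hz : 0 < z.re) :
    ∫ u in Set.Ioi (0 : ℝ), ((Chebyshev.psi (Real.exp u) * Real.exp (-u) : ℝ) : ℂ) * cexp (-z * u) =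
      LSeries (fun n => (ArithmeticFunction.vonMangoldt n : ℂ)) (1 + z) / (1 + z) := by
  have hs : 1 < (1 + z).re := by simpa using hz
  have hne : (1 + z) ≠ 0 := by
    intro h; rw [h] at hs; norm_num at hs
  have h := LSeries_eq_mul_integral_of_nonneg (fun n => ArithmeticFunction.vonMangoldt n)
    zero_le_one hs psi_isBigO (fun n => ArithmeticFunction.vonMangoldt_nonneg)
  rw [h, mul_div_cancel_left₀ _ hne]
  have himg : Real.exp '' Set.Ioi 0 = Set.Ioi 1 := by
    ext x; constructor
    · rintro ⟨u, hu, rfl⟩; exact Real.one_lt_exp_iff.2 hu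
    · intro hx
      exact ⟨Real.log x, Real.log_pos hx, Real.exp_log (zero_lt_one.trans hx)⟩
  rw [← himg, integral_image_eq_integral_abs_deriv_smul measurableSet_Ioi
    (fun x _ => (Real.hasDerivAt_exp x).hasDerivWithinAt) Real.exp_injective.injOn]
  congr 1 with u
  have e : ∑ k ∈ Finset.Icc 1 ⌊Real.exp u⌋₊, (ArithmeticFunction.vonMangoldt k : ℂ) =
      (Chebyshev.psi (Real.exp u) : ℂ) := by
    rw [Chebyshev.psi]; push_cast; rfl
  have e2 : ((Real.exp u : ℝ) : ℂ) ^ (-(1 + z + 1)) = cexp (-(z + 2) * u) := by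
    rw [Complex.cpow_def_of_ne_zero (by exact_mod_cast (Real.exp_pos u).ne'),
      ← Complex.ofReal_log (Real.exp_pos u).le, Real.log_exp]
    congr 1; ring
  rw [e, e2, abs_of_pos (Real.exp_pos u), Complex.real_smul]
  have e3 : cexp (-u) * cexp (-z * u) = cexp u * cexp (-(z + 2) * u) := by
    rw [← Complex.exp_add, ← Complex.exp_add]; congr 1; ring
  push_cast
  linear_combination (Chebyshev.psi (Real.exp u) : ℂ) * e3

theorem exists_laplace_psi_sub_one : ∃ G : ℂ → ℂ, ContinuousOn G {z | 0 ≤ z.re} ∧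
    ∀ z : ℂ, 0 < z.re → ∫ u in Set.Ioi (0 : ℝ),
      ((Chebyshev.psi (Real.exp u) * Real.exp (-u) - 1 : ℝ) : ℂ) * cexp (-z * u) = G z := by
  refine ⟨fun z => (ArithmeticFunction.vonMangoldt.LFunctionResidueClassAux (1 : ZMod 1) (1 + z) - 1)
    / (1 + z), ?_, ?_⟩
  · apply ContinuousOn.div _ (by fun_prop)
    · intro z hz h
      have : (1 + z).re = 0 := by rw [h]; simp
      simp at hz this
      linarith
    · refine ContinuousOn.sub ?_ continuousOn_const
      refine (ArithmeticFunction.vonMangoldt.continuousOn_LFunctionResidueClassAux (1 : ZMod 1)).comp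
        (by fun_prop) fun z hz => ?_
      simpa using hz
  · intro z hz
    have hs : 1 < (1 + z).re := by simpa using hz
    have hne : (1 + z) ≠ 0 := by
      intro h; rw [h] at hs; norm_num at hs
    have hz0 : z ≠ 0 := by
      rintro rfl; simp at hz
    have h1 : ∫ u in Set.Ioi (0 : ℝ), cexp (-z * u) = 1 / z := by
      rw [integral_exp_mul_complex_Ioi (by simpa using hz)]
      simp
    have hi1 : IntegrableOn (fun u : ℝ => cexp (-z * u)) (Set.Ioi 0) :=
      integrableOn_exp_mul_complex_Ioi (by simpa using hz) 0
    have hi2 : IntegrableOn (fun u : ℝ => ((Chebyshev.psi (Real.exp u) * Real.exp (-u) : ℝ) : ℂ)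
        * cexp (-z * u)) (Set.Ioi 0) := by
      refine Integrable.bdd_mul (c := Real.log 4 + 4) hi1 ?_ ?_
      · have := Chebyshev.psi_mono.measurable
        apply Measurable.aestronglyMeasurable; fun_prop
      · refine ae_of_all _ fun u => ?_
        rw [Complex.norm_real, Real.norm_of_nonneg
          (mul_nonneg (Chebyshev.psi_nonneg _) (Real.exp_pos _).le), Real.exp_neg,
          ← div_eq_mul_inv, div_le_iff₀ (Real.exp_pos u)]
        exact Chebyshev.psi_le_const_mul_self (Real.exp_pos u).le
    have hA := ArithmeticFunction.vonMangoldt.eqOn_LFunctionResidueClassAux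
      (a := (1 : ZMod 1)) isUnit_one hs
    have hR : ArithmeticFunction.vonMangoldt.residueClass (1 : ZMod 1) =
        fun n => ArithmeticFunction.vonMangoldt n := by
      ext n
      rw [ArithmeticFunction.vonMangoldt.residueClass, Set.indicator_of_mem]
      exact Subsingleton.elim _ _
    rw [hR] at hA
    simp only at hA ⊢
    rw [hA]
    simp only [ofReal_sub, ofReal_one, sub_mul, one_mul]
    rw [integral_sub hi2 hi1, h1, laplace_psi hz]
    simp only [Nat.totient_one, Nat.cast_one, inv_one, add_sub_cancel_left]
    field_simp
    ring

end

section
open MeasureTheory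

theorem tendsto_setIntegral_sinc_sq {l : ℝ} (hl : 0 < l) :
    Tendsto (fun y : ℝ => ∫ u in Set.Ioi (0 : ℝ), Real.sinc (l * (y - u) / 2) ^ 2) atTop
      (nhds (l⁻¹ * ∫ v : ℝ, Real.sinc (v / 2) ^ 2)) := by
  have h1 : ∀ y : ℝ, ∫ u in Set.Ioi (0 : ℝ), Real.sinc (l * (y - u) / 2) ^ 2 =
      ∫ v in Set.Iio y, Real.sinc (l * v / 2) ^ 2 := by
    intro y
    rw [← integral_indicator measurableSet_Ioi, ← integral_indicator measurableSet_Iio,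
      ← integral_sub_left_eq_self _ volume y]
    congr 1 with u
    simp [Set.indicator_apply]
  have h2 : ∫ v : ℝ, Real.sinc (l * v / 2) ^ 2 = l⁻¹ * ∫ v : ℝ, Real.sinc (v / 2) ^ 2 := by
    rw [Measure.integral_comp_mul_left (fun v : ℝ => Real.sinc (v / 2) ^ 2) l,
      abs_of_pos (inv_pos.2 hl), smul_eq_mul]
  simp_rw [h1]
  rw [← h2]
  exact (aecover_Iio tendsto_id).integral_tendsto_of_countably_generated
    (integrable_sinc_half_sq.comp_mul_left' hl.ne')

theorem integral_sinc_sq_window {l : ℝ} (hl : 0 < l) (c η : ℝ) :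
    ∫ u in (c - η)..(c + η), Real.sinc (l * (c - u) / 2) ^ 2 =
      l⁻¹ * ∫ v in (-(l * η))..(l * η), Real.sinc (v / 2) ^ 2 := by
  rw [intervalIntegral.integral_comp_sub_left (fun v : ℝ => Real.sinc (l * v / 2) ^ 2) c,
    intervalIntegral.integral_comp_mul_left (fun v : ℝ => Real.sinc (v / 2) ^ 2) hl.ne',
    smul_eq_mul]
  congr 2 <;> ring

theorem integral_sinc_half_sq_pos : 0 < ∫ v : ℝ, Real.sinc (v / 2) ^ 2 := by
  refine integral_pos_of_integrable_nonneg_nonzero (x := 0) ?_ integrable_sinc_half_sq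
    (fun v => by positivity) (by simp)
  have := Real.continuous_sinc
  fun_prop

theorem tendsto_psi_exp_mul :
    Tendsto (fun u : ℝ => Chebyshev.psi (Real.exp u) * Real.exp (-u)) atTop (nhds 1) := by
  set B : ℝ → ℝ := fun u => Chebyshev.psi (Real.exp u) * Real.exp (-u) with hB
  set κ := ∫ v : ℝ, Real.sinc (v / 2) ^ 2 with hκ
  have hκ0 : 0 < κ := integral_sinc_half_sq_pos
  set C := Real.log 4 + 4 with hC
  have hC0 : 0 < C := by have := Real.log_pos (show (1 : ℝ) < 4 by norm_num); linarith
  have hB0 : ∀ u, 0 ≤ B u := fun u => mul_nonneg (Chebyshev.psi_nonneg _) (Real.exp_pos _).le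
  have hBC : ∀ u, B u ≤ C := fun u => by
    simp only [hB]
    rw [Real.exp_neg, ← div_eq_mul_inv, div_le_iff₀ (Real.exp_pos u)]
    exact Chebyshev.psi_le_const_mul_self (Real.exp_pos u).le
  have hBm : Measurable B := by
    have := Chebyshev.psi_mono.measurable
    fun_prop
  have hBmono : ∀ u v, u ≤ v → B u * Real.exp (u - v) ≤ B v := by
    intro u v huv
    simp only [hB]
    rw [mul_assoc, ← Real.exp_add, show -u + (u - v) = -v by ring]
    have := Chebyshev.psi_mono (Real.exp_le_exp.2 huv)
    gcongr
  have hInt : ∀ {l : ℝ}, 0 < l → ∀ y, Integrable fun u => B u * Real.sinc (l * (y - u) / 2) ^ 2 := by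
    intro l hl y
    refine (integrable_sinc_sq_comp hl.ne' y).bdd_mul (c := C) hBm.aestronglyMeasurable ?_
    exact ae_of_all _ fun u => by rw [Real.norm_of_nonneg (hB0 u)]; exact hBC u
  obtain ⟨G, hG, hGeq⟩ := exists_laplace_psi_sub_one
  have hT : ∀ {l : ℝ}, 0 < l → Tendsto (fun y : ℝ => ∫ u in Set.Ioi (0 : ℝ),
      B u * Real.sinc (l * (y - u) / 2) ^ 2) atTop (nhds (l⁻¹ * κ)) := by
    intro l hl
    have h1 := (tendsto_fejer_conv (b := fun u => B u - 1) (hBm.sub_const 1) (C := C + 1)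
      (fun u => by
        rw [abs_le]; constructor <;> linarith [hB0 u, hBC u]) hG hGeq hl).add
      (tendsto_setIntegral_sinc_sq hl)
    rw [zero_add] at h1
    refine h1.congr fun y => ?_
    rw [← integral_add]
    · congr 1 with u; ring
    · have := (hInt hl y).sub (integrable_sinc_sq_comp hl.ne' y)
      refine (this.congr (ae_of_all _ fun u => ?_)).integrableOn
      simp only [Pi.sub_apply]; ring
    · exact (integrable_sinc_sq_comp hl.ne' y).integrableOn
  have hupper : ∀ {l η : ℝ}, 0 < l → 0 < η → ∀ y > 0,
      B y * Real.exp (-(2 * η)) * (l⁻¹ * ∫ v in (-(l * η))..(l * η), Real.sinc (v / 2) ^ 2) ≤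
        ∫ u in Set.Ioi (0 : ℝ), B u * Real.sinc (l * ((y + η) - u) / 2) ^ 2 := by
    intro l η hl hη y hy
    rw [← integral_sinc_sq_window hl (y + η) η, intervalIntegral.integral_of_le (by linarith),
      ← integral_const_mul]
    refine le_trans (setIntegral_mono_on ?_ (hInt hl (y + η)).integrableOn measurableSet_Ioc ?_)
      (setIntegral_mono_set (hInt hl (y + η)).integrableOn
        (ae_of_all _ fun u => mul_nonneg (hB0 u) (sq_nonneg _)) ?_)
    · exact ((integrable_sinc_sq_comp hl.ne' (y + η)).const_mul _).integrableOn
    · intro u hu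
      refine mul_le_mul_of_nonneg_right ?_ (sq_nonneg _)
      refine le_trans ?_ (hBmono y u (by linarith [hu.1]))
      refine mul_le_mul_of_nonneg_left (Real.exp_le_exp.2 (by linarith [hu.2])) (hB0 y)
    · refine (show Set.Ioc (y + η - η) (y + η + η) ⊆ Set.Ioi 0 from fun u hu => ?_).eventuallyLE
      simp only [Set.mem_Ioi]; linarith [hu.1]
  have hlower : ∀ {l η : ℝ}, 0 < l → 0 < η → ∀ y,
      ∫ u in Set.Ioi (0 : ℝ), B u * Real.sinc (l * ((y - η) - u) / 2) ^ 2 ≤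
        B y * Real.exp (2 * η) * (l⁻¹ * κ) +
        C * (l⁻¹ * κ - l⁻¹ * ∫ v in (-(l * η))..(l * η), Real.sinc (v / 2) ^ 2) := by
    intro l η hl hη y
    have hi := integrable_sinc_sq_comp hl.ne' (y - η)
    have hi2 := hi.indicator (measurableSet_Ioc (a := y - η - η) (b := y - η + η))
    have hi3 : Integrable fun u => Real.sinc (l * (y - η - u) / 2) ^ 2 -
        (Set.Ioc (y - η - η) (y - η + η)).indicator
          (fun u => Real.sinc (l * (y - η - u) / 2) ^ 2) u := hi.sub hi2
    have h2 : ∫ v : ℝ, Real.sinc (l * (y - η - v) / 2) ^ 2 = l⁻¹ * κ := by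
      rw [integral_sub_left_eq_self (fun v : ℝ => Real.sinc (l * v / 2) ^ 2) volume (y - η),
        Measure.integral_comp_mul_left (fun v : ℝ => Real.sinc (v / 2) ^ 2) l,
        abs_of_pos (inv_pos.2 hl), smul_eq_mul]
    rw [← integral_sinc_sq_window hl (y - η) η, intervalIntegral.integral_of_le (by linarith),
      ← integral_indicator measurableSet_Ioc, ← h2, ← integral_sub hi hi2, ← integral_const_mul,
      ← integral_const_mul, ← integral_add (hi.const_mul _) (hi3.const_mul _)]
    refine (setIntegral_le_integral (hInt hl _)
      (ae_of_all _ fun u => mul_nonneg (hB0 u) (sq_nonneg _))).trans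
      (integral_mono (hInt hl _) ((hi.const_mul _).add (hi3.const_mul _)) fun u => ?_)
    set s := Real.sinc (l * (y - η - u) / 2) ^ 2 with hs
    have hs0 : 0 ≤ s := sq_nonneg _
    by_cases hu : u ∈ Set.Ioc (y - η - η) (y - η + η)
    · simp only [Set.indicator_of_mem hu, ← hs, sub_self, mul_zero, add_zero]
      refine mul_le_mul_of_nonneg_right ?_ hs0
      have h3 := hBmono u y (by linarith [hu.2])
      have h4 : Real.exp (-(2 * η)) ≤ Real.exp (u - y) := Real.exp_le_exp.2 (by linarith [hu.1])
      have h5 : B u * Real.exp (-(2 * η)) ≤ B y :=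
        (mul_le_mul_of_nonneg_left h4 (hB0 u)).trans h3
      rw [Real.exp_neg, ← div_eq_mul_inv, div_le_iff₀ (Real.exp_pos _)] at h5
      exact h5
    · simp only [Set.indicator_of_notMem hu, sub_zero]
      have h3 : B u * s ≤ C * s := mul_le_mul_of_nonneg_right (hBC u) hs0
      have h4 : 0 ≤ B y * Real.exp (2 * η) * s :=
        mul_nonneg (mul_nonneg (hB0 y) (Real.exp_pos _).le) hs0
      linarith
  rw [Metric.tendsto_nhds]
  intro ε hε
  obtain ⟨η, hη, hη1, hηu, hηl⟩ : ∃ η : ℝ, 0 < η ∧ η < 1 ∧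
      Real.exp (2 * η) * ((1 + η) / (1 - η)) < 1 + ε ∧
      1 - ε < Real.exp (-(2 * η)) * (1 - η - C * η) := by
    have t1 : Tendsto (fun η : ℝ => Real.exp (2 * η) * ((1 + η) / (1 - η))) (nhdsWithin 0 (Set.Ioi 0))
        (nhds 1) := by
      have : ContinuousAt (fun η : ℝ => Real.exp (2 * η) * ((1 + η) / (1 - η))) 0 := by
        refine ContinuousAt.mul (by fun_prop) (ContinuousAt.div (by fun_prop) (by fun_prop) (by simp))
      simpa [ContinuousAt] using this.tendsto.mono_left nhdsWithin_le_nhds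
    have t2 : Tendsto (fun η : ℝ => Real.exp (-(2 * η)) * (1 - η - C * η)) (nhdsWithin 0 (Set.Ioi 0))
        (nhds 1) := by
      have : ContinuousAt (fun η : ℝ => Real.exp (-(2 * η)) * (1 - η - C * η)) 0 := by fun_prop
      simpa [ContinuousAt] using this.tendsto.mono_left nhdsWithin_le_nhds
    have e3 : ∀ᶠ η : ℝ in nhdsWithin 0 (Set.Ioi 0), η ∈ Set.Ioo (0 : ℝ) 1 :=
      Ioo_mem_nhdsGT (by norm_num)
    obtain ⟨η, h1, h2, h3⟩ := ((t1.eventually_lt_const (show (1 : ℝ) < 1 + ε by linarith)).and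
      ((t2.eventually_const_lt (show 1 - ε < (1 : ℝ) by linarith)).and e3)).exists
    exact ⟨η, h3.1, h3.2, h1, h2⟩
  obtain ⟨T, hTpos, hTI⟩ : ∃ T : ℝ, 0 < T ∧
      (1 - η) * κ < ∫ v in (-T)..T, Real.sinc (v / 2) ^ 2 := by
    have := (intervalIntegral_tendsto_integral integrable_sinc_half_sq tendsto_neg_atTop_atBot
      tendsto_id).eventually_const_lt (show (1 - η) * κ < κ by nlinarith)
    obtain ⟨T, h1, h2⟩ := (this.and (eventually_gt_atTop 0)).exists
    exact ⟨T, h2, h1⟩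
  set l := T / η with hl
  have hl0 : 0 < l := by positivity
  have hlη : l * η = T := by rw [hl]; field_simp
  set J := ∫ v in (-T)..T, Real.sinc (v / 2) ^ 2 with hJ
  have a1 := ((hT hl0).comp (tendsto_atTop_add_const_right atTop η tendsto_id)).eventually_lt_const
    (show l⁻¹ * κ < l⁻¹ * ((1 + η) * κ) by
      have := inv_pos.2 hl0
      gcongr; nlinarith)
  have a2 := ((hT hl0).comp (tendsto_atTop_add_const_right atTop (-η) tendsto_id)).eventually_const_lt
    (show l⁻¹ * ((1 - η) * κ) < l⁻¹ * κ by
      have := inv_pos.2 hl0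
      gcongr; nlinarith)
  filter_upwards [a1, a2, eventually_gt_atTop 0] with y h1 h2 hy
  have u1 := hupper hl0 hη y hy
  have u2 := hlower hl0 hη y
  simp only [Function.comp, id, ← sub_eq_add_neg] at h1 h2
  rw [hlη, ← hJ] at u1 u2
  have hli := inv_pos.2 hl0
  rw [Real.dist_eq, abs_lt]
  constructor
  · have h3 : (1 - η) * κ < B y * Real.exp (2 * η) * κ + C * (κ - J) := by
      have := h2.trans_le u2
      have h4 : l⁻¹ * ((1 - η) * κ) < l⁻¹ * (B y * Real.exp (2 * η) * κ + C * (κ - J)) := by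
        linarith
      exact lt_of_mul_lt_mul_left h4 hli.le
    have h4 : (1 - η - C * η) * κ < (B y * Real.exp (2 * η)) * κ := by nlinarith
    have h5 := lt_of_mul_lt_mul_right h4 hκ0.le
    have h6 : Real.exp (-(2 * η)) * (1 - η - C * η) < B y := by
      rw [Real.exp_neg, inv_mul_lt_iff₀ (Real.exp_pos _)]; linarith
    linarith
  · have h3 : B y * Real.exp (-(2 * η)) * J < (1 + η) * κ := by
      have := u1.trans_lt h1
      have h4 : l⁻¹ * (B y * Real.exp (-(2 * η)) * J) < l⁻¹ * ((1 + η) * κ) := by linarith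
      exact lt_of_mul_lt_mul_left h4 hli.le
    have h4 : B y * Real.exp (-(2 * η)) * ((1 - η) * κ) ≤ B y * Real.exp (-(2 * η)) * J :=
      mul_le_mul_of_nonneg_left hTI.le (mul_nonneg (hB0 y) (Real.exp_pos _).le)
    have h5 : (B y * Real.exp (-(2 * η)) * (1 - η)) * κ < (1 + η) * κ := by linarith
    have h6 := lt_of_mul_lt_mul_right h5 hκ0.le
    have h7 : B y < Real.exp (2 * η) * ((1 + η) / (1 - η)) := by
      rw [Real.exp_neg] at h6
      have : 0 < 1 - η := by linarith
      rw [← mul_div_assoc, lt_div_iff₀ this]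
      have e := Real.exp_pos (2 * η)
      have h8 : B y * (Real.exp (2 * η))⁻¹ * (1 - η) = (B y * (1 - η)) / Real.exp (2 * η) := by
        field_simp
      rw [h8, div_lt_iff₀ e] at h6
      linarith
    linarith

/-- The prime number theorem, for the Chebyshev function `ψ`. -/
theorem tendsto_psi_div_self : Tendsto (fun x : ℝ => Chebyshev.psi x / x) atTop (nhds 1) := by
  refine (tendsto_psi_exp_mul.comp Real.tendsto_log_atTop).congr' ?_
  filter_upwards [eventually_gt_atTop 0] with x hx
  simp only [Function.comp, Real.exp_neg, Real.exp_log hx, div_eq_mul_inv]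

end

section LogAverage

/-- The harmonic sum `∑_{n ≤ N} 1/n` as a real number. -/
noncomputable def harmonicSum (N : ℕ) : ℝ := ∑ n ∈ Icc 1 N, (n : ℝ)⁻¹

theorem harmonicSum_eq (N : ℕ) : harmonicSum N = (harmonic N : ℚ) := by
  rw [harmonicSum, harmonic_eq_sum_Icc]; push_cast; rfl

theorem log_le_harmonicSum (N : ℕ) : Real.log N ≤ harmonicSum N := by
  rw [harmonicSum_eq]
  rcases N.eq_zero_or_pos with rfl | hN
  · simp
  refine le_trans (Real.log_le_log (by exact_mod_cast hN) ?_) (log_add_one_le_harmonic N)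
  push_cast; linarith

theorem harmonicSum_le (N : ℕ) : harmonicSum N ≤ 1 + Real.log N := by
  rw [harmonicSum_eq]; exact harmonic_le_one_add_log N

theorem one_le_harmonicSum {N : ℕ} (hN : 1 ≤ N) : 1 ≤ harmonicSum N := by
  have := single_le_sum (f := fun n : ℕ => (n : ℝ)⁻¹) (fun _ _ => by positivity)
    (mem_Icc.2 ⟨le_rfl, hN⟩)
  simpa [harmonicSum] using this

theorem tendsto_harmonicSum : Tendsto harmonicSum atTop atTop :=
  tendsto_atTop_mono log_le_harmonicSum
    (Real.tendsto_log_atTop.comp tendsto_natCast_atTop_atTop)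

variable {E : Type*} [NormedAddCommGroup E] [NormedSpace ℝ E]

/-- The logarithmic average `(∑_{n ≤ N} 1/n)⁻¹ ∑_{n ≤ N} g(n)/n`. -/
noncomputable def logAvg (N : ℕ) (g : ℕ → E) : E :=
  (harmonicSum N)⁻¹ • ∑ n ∈ Icc 1 N, (n : ℝ)⁻¹ • g n

theorem logAvg_add (N : ℕ) (f g : ℕ → E) :
    logAvg N (fun n => f n + g n) = logAvg N f + logAvg N g := by
  simp [logAvg, smul_add, sum_add_distrib]

theorem logAvg_sub (N : ℕ) (f g : ℕ → E) :
    logAvg N (fun n => f n - g n) = logAvg N f - logAvg N g := by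
  simp [logAvg, smul_sub, sum_sub_distrib]

theorem logAvg_const {N : ℕ} (hN : 1 ≤ N) (a : E) : logAvg N (fun _ => a) = a := by
  have := one_le_harmonicSum hN
  rw [logAvg, ← sum_smul, smul_smul, ← harmonicSum, inv_mul_cancel₀ (by linarith), one_smul]

theorem logAvg_sum {ι : Type*} (s : Finset ι) (N : ℕ) (f : ι → ℕ → E) :
    logAvg N (fun n => ∑ i ∈ s, f i n) = ∑ i ∈ s, logAvg N (f i) := by
  simp only [logAvg, smul_sum]
  rw [sum_comm]

theorem logAvg_const_mul {𝕜 : Type*} [NormedRing 𝕜] [NormedAlgebra ℝ 𝕜] (N : ℕ) (a : 𝕜)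
    (f : ℕ → 𝕜) : logAvg N (fun n => a * f n) = a * logAvg N f := by
  simp only [logAvg, smul_sum, mul_sum, mul_smul_comm]

theorem harmonicSum_nonneg (N : ℕ) : 0 ≤ harmonicSum N := sum_nonneg fun _ _ => by positivity

theorem logAvg_congr {N : ℕ} {f g : ℕ → E} (h : ∀ n ∈ Icc 1 N, f n = g n) :
    logAvg N f = logAvg N g := by
  simp only [logAvg]
  rw [sum_congr rfl fun n hn => by rw [h n hn]]

theorem logAvg_mono {N : ℕ} {f g : ℕ → ℝ} (h : ∀ n ∈ Icc 1 N, f n ≤ g n) :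
    logAvg N f ≤ logAvg N g := by
  have := harmonicSum_nonneg N
  simp only [logAvg, smul_eq_mul]
  gcongr with n hn
  exact h n hn

theorem norm_logAvg_le (N : ℕ) (f : ℕ → E) : ‖logAvg N f‖ ≤ logAvg N (fun n => ‖f n‖) := by
  have := harmonicSum_nonneg N
  rw [logAvg, logAvg, norm_smul, norm_inv, Real.norm_of_nonneg this, smul_eq_mul]
  gcongr
  refine (norm_sum_le _ _).trans (le_of_eq (sum_congr rfl fun n _ => ?_))
  rw [norm_smul, norm_inv, Real.norm_natCast, smul_eq_mul]

theorem norm_logAvg_le_of_le {N : ℕ} {f : ℕ → E} {g : ℕ → ℝ}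
    (h : ∀ n ∈ Icc 1 N, ‖f n‖ ≤ g n) : ‖logAvg N f‖ ≤ logAvg N g :=
  (norm_logAvg_le N f).trans (logAvg_mono h)

theorem sum_Icc_sum_divisorsAntidiagonal {E : Type*} [AddCommMonoid E] (N : ℕ) (F : ℕ → ℕ → E) :
    ∑ n ∈ Icc 1 N, ∑ x ∈ n.divisorsAntidiagonal, F x.1 x.2 =
      ∑ m ∈ Icc 1 N, ∑ q ∈ Icc 1 (N / m), F m q := by
  rw [sum_sigma', sum_sigma']
  refine sum_bij' (fun x _ => ⟨x.2.1, x.2.2⟩) (fun y _ => ⟨y.1 * y.2, (y.1, y.2)⟩) ?_ ?_ ?_ ?_ ?_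
  · rintro ⟨n, a, b⟩ h
    simp only [mem_sigma, mem_Icc, Nat.mem_divisorsAntidiagonal] at h ⊢
    obtain ⟨⟨h1, h2⟩, rfl, h4⟩ := h
    have ha : 0 < a := Nat.pos_of_ne_zero (by rintro rfl; simp at h4)
    have hb : 0 < b := Nat.pos_of_ne_zero (by rintro rfl; simp at h4)
    refine ⟨⟨ha, (Nat.le_mul_of_pos_right a hb).trans h2⟩, hb, ?_⟩
    rw [Nat.le_div_iff_mul_le ha, mul_comm]; exact h2
  · rintro ⟨a, b⟩ h
    simp only [mem_sigma, mem_Icc, Nat.mem_divisorsAntidiagonal] at h ⊢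
    obtain ⟨⟨h1, h2⟩, h3, h4⟩ := h
    rw [Nat.le_div_iff_mul_le h1, mul_comm] at h4
    have : 0 < a * b := Nat.mul_pos h1 h3
    exact ⟨⟨this, h4⟩, trivial, this.ne'⟩
  · rintro ⟨n, a, b⟩ h
    simp only [mem_sigma, mem_Icc, Nat.mem_divisorsAntidiagonal] at h ⊢
    obtain ⟨-, rfl, -⟩ := h
    rfl
  · rintro ⟨a, b⟩ h; rfl
  · rintro ⟨n, a, b⟩ h; rfl

theorem bigOmega_mul_prime {m q : ℕ} (hm : m ≠ 0) (hq : q.Prime) :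
    bigOmega (m * q) = bigOmega m + 1 := by
  have := ArithmeticFunction.cardFactors_mul hm hq.ne_zero
  rwa [ArithmeticFunction.cardFactors_apply, ArithmeticFunction.cardFactors_apply,
    ArithmeticFunction.cardFactors_apply_prime hq] at this

theorem psi_natCast_div (N m : ℕ) :
    Chebyshev.psi ((N : ℝ) / m) = ∑ q ∈ Icc 1 (N / m), ArithmeticFunction.vonMangoldt q := by
  rw [Chebyshev.psi, Nat.floor_div_eq_div]; rfl

theorem sum_inv_sqrt_le (N : ℕ) : ∑ m ∈ Icc 1 N, (Real.sqrt m)⁻¹ ≤ 2 * Real.sqrt N := by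
  induction N with
  | zero => simp
  | succ n ih =>
    rw [sum_Icc_succ_top (by omega)]
    have h1 := Real.sqrt_nonneg n
    have h2 : 0 < Real.sqrt (n + 1 : ℕ) := Real.sqrt_pos.2 (by positivity)
    have h3 := Real.sq_sqrt (show (0 : ℝ) ≤ n by positivity)
    have h4 := Real.sq_sqrt (show (0 : ℝ) ≤ (n + 1 : ℕ) by positivity)
    push_cast at *
    set a := Real.sqrt n
    set b := Real.sqrt (n + 1)
    have : b⁻¹ ≤ 2 * (b - a) := by
      rw [inv_le_iff_one_le_mul₀ h2]
      nlinarith [sq_nonneg (a - b)]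
    linarith

theorem sum_sqrt_div_le (N : ℕ) : ∑ m ∈ Icc 1 N, Real.sqrt ((N : ℝ) / m) ≤ 2 * N := by
  calc ∑ m ∈ Icc 1 N, Real.sqrt ((N : ℝ) / m)
      = Real.sqrt N * ∑ m ∈ Icc 1 N, (Real.sqrt m)⁻¹ := by
        rw [mul_sum]
        exact sum_congr rfl fun m _ => by rw [Real.sqrt_div (by positivity), div_eq_mul_inv]
    _ ≤ Real.sqrt N * (2 * Real.sqrt N) := by gcongr; exact sum_inv_sqrt_le N
    _ = 2 * N := by
        have := Real.mul_self_sqrt (show (0 : ℝ) ≤ N by positivity)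
        linarith

theorem exists_norm_sum_log_mul_sub_le : ∃ C : ℝ, ∀ (f : ℕ → ℂ), (∀ k, ‖f k‖ ≤ 1) → ∀ N : ℕ,
    ‖∑ n ∈ Icc 1 N, (Real.log n : ℂ) * f (bigOmega n) -
      ∑ m ∈ Icc 1 N, (Chebyshev.psi ((N : ℝ) / m) : ℂ) * f (bigOmega m + 1)‖ ≤ C * N := by
  obtain ⟨C, hC⟩ := Chebyshev.psi_sub_theta_le_mul_sqrt
  have hC0 : 0 ≤ C := by
    have := (sub_nonneg.2 (Chebyshev.theta_le_psi 1)).trans (hC 1)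
    simpa using this
  refine ⟨4 * C, fun f hf N => ?_⟩
  have h1 : ∑ n ∈ Icc 1 N, (Real.log n : ℂ) * f (bigOmega n) =
      ∑ m ∈ Icc 1 N, ∑ q ∈ Icc 1 (N / m),
        (ArithmeticFunction.vonMangoldt q : ℂ) * f (bigOmega (m * q)) := by
    rw [← sum_Icc_sum_divisorsAntidiagonal N
      (fun m q => (ArithmeticFunction.vonMangoldt q : ℂ) * f (bigOmega (m * q)))]
    refine sum_congr rfl fun n _ => ?_
    rw [← ArithmeticFunction.vonMangoldt_sum, ← Nat.sum_divisorsAntidiagonal'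
      (fun _ q => ArithmeticFunction.vonMangoldt q)]
    push_cast
    rw [sum_mul]
    refine sum_congr rfl fun x hx => ?_
    rw [(Nat.mem_divisorsAntidiagonal.1 hx).1]
  rw [h1, ← sum_sub_distrib]
  refine (norm_sum_le _ _).trans ?_
  calc _ ≤ ∑ m ∈ Icc 1 N, 2 * C * Real.sqrt ((N : ℝ) / m) := by
        refine sum_le_sum fun m hm => ?_
        have hm0 : m ≠ 0 := by have := (mem_Icc.1 hm).1; omega
        refine le_trans ?_ (show 2 * (Chebyshev.psi ((N : ℝ) / m) - Chebyshev.theta ((N : ℝ) / m))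
          ≤ _ by have := hC ((N : ℝ) / m); linarith)
        rw [Chebyshev.psi_sub_theta_eq_sum_not_prime, psi_natCast_div, Nat.floor_div_eq_div,
          Complex.ofReal_sum, sum_mul, ← sum_sub_distrib, sum_filter, mul_sum]
        refine (norm_sum_le _ _).trans (sum_le_sum fun q _ => ?_)
        rw [← mul_sub, norm_mul, Complex.norm_real, Real.norm_of_nonneg
          ArithmeticFunction.vonMangoldt_nonneg]
        split_ifs with hq
        · rw [bigOmega_mul_prime hm0 hq]; simp
        · rw [mul_comm (2 : ℝ)]
          refine mul_le_mul_of_nonneg_left ?_ ArithmeticFunction.vonMangoldt_nonneg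
          exact (norm_sub_le _ _).trans (by linarith [hf (bigOmega (m * q)), hf (bigOmega m + 1)])
    _ ≤ 4 * C * N := by
        rw [← mul_sum]
        have := mul_le_mul_of_nonneg_left (sum_sqrt_div_le N) hC0
        linarith

theorem sum_log_natCast_div_le (N : ℕ) : ∑ n ∈ Icc 1 N, (Real.log N - Real.log n) ≤ N := by
  rcases N.eq_zero_or_pos with rfl | hN
  · simp
  have h : ∑ n ∈ Icc 1 N, Real.log n = Real.log (N.factorial) := by
    rw [← Finset.prod_Ico_id_eq_factorial, Finset.Ico_add_one_right_eq_Icc]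
    push_cast
    rw [Real.log_prod]
    intro i hi
    have := (mem_Icc.1 hi).1
    positivity
  rw [sum_sub_distrib, h, sum_const, Nat.card_Icc, nsmul_eq_mul]
  have := Stirling.le_log_factorial_stirling hN.ne'
  have h2 : 0 ≤ Real.log N := Real.log_natCast_nonneg N
  have h3 : 0 ≤ Real.log (2 * Real.pi) := Real.log_nonneg (by linarith [Real.pi_gt_three])
  simp only [add_tsub_cancel_right]
  linarith

theorem exists_abs_psi_sub_le {ε : ℝ} (hε : 0 < ε) :
    ∃ C : ℝ, 0 ≤ C ∧ ∀ x : ℝ, 0 ≤ x → |Chebyshev.psi x - x| ≤ ε * x + C := by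
  obtain ⟨X, hX⟩ := eventually_atTop.1 (Metric.tendsto_nhds.1 tendsto_psi_div_self ε hε)
  set Y := max X 1
  have hY : 1 ≤ Y := le_max_right _ _
  refine ⟨Chebyshev.psi Y + Y, add_nonneg (Chebyshev.psi_nonneg _) (by linarith), fun x hx => ?_⟩
  rcases le_total Y x with h | h
  · have h1 := hX x ((le_max_left _ _).trans h)
    have hx0 : 0 < x := by linarith
    rw [Real.dist_eq, show Chebyshev.psi x / x - 1 = (Chebyshev.psi x - x) / x by field_simp,
      abs_div, abs_of_pos hx0, div_lt_iff₀ hx0] at h1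
    linarith [Chebyshev.psi_nonneg Y]
  · have h1 := Chebyshev.psi_mono h
    have h2 := Chebyshev.psi_nonneg x
    have h3 : 0 ≤ ε * x := by positivity
    rw [abs_le]; constructor <;> linarith

/-- Cesàro averages of a bounded function of `Ω` agree asymptotically with the logarithmic averages
of its shift. This is where the prime number theorem enters. -/
theorem tendsto_average_sub_logAvg {f : ℕ → ℂ} (hf : ∀ k, ‖f k‖ ≤ 1) :
    Tendsto (fun N : ℕ => (N : ℂ)⁻¹ * ∑ n ∈ Icc 1 N, f (bigOmega n) -
      logAvg N (fun n => f (bigOmega n + 1))) atTop (nhds 0) := by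
  obtain ⟨C₁, hC₁⟩ := exists_norm_sum_log_mul_sub_le
  rw [Metric.tendsto_nhds]
  intro ε hε
  obtain ⟨C₂, hC₂, hψ⟩ := exists_abs_psi_sub_le (half_pos hε)
  filter_upwards [eventually_ge_atTop 1,
    tendsto_harmonicSum.eventually_gt_atTop ((2 + C₁ + C₂) / (ε / 2))] with N hN hH
  rw [dist_zero_right]
  have hN0 : (0 : ℝ) < N := by exact_mod_cast hN
  have hH0 : 0 < harmonicSum N := by linarith [one_le_harmonicSum hN]
  set S := ∑ n ∈ Icc 1 N, f (bigOmega n) with hS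
  set L := logAvg N (fun n => f (bigOmega n + 1)) with hL
  have hSN : ‖S‖ ≤ N := by
    refine (norm_sum_le _ _).trans ((sum_le_sum fun n _ => hf _).trans ?_)
    simp
  have e1 : ‖((harmonicSum N - Real.log N : ℝ) : ℂ) * S‖ ≤ N := by
    rw [norm_mul, Complex.norm_real, Real.norm_of_nonneg (by linarith [log_le_harmonicSum N])]
    nlinarith [harmonicSum_le N, norm_nonneg S, log_le_harmonicSum N]
  have e2 : ‖(Real.log N : ℂ) * S - ∑ n ∈ Icc 1 N, (Real.log n : ℂ) * f (bigOmega n)‖ ≤ N := by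
    rw [hS, mul_sum, ← sum_sub_distrib]
    refine (norm_sum_le _ _).trans (le_trans (sum_le_sum fun n hn => ?_) (sum_log_natCast_div_le N))
    obtain ⟨h1, h2⟩ := mem_Icc.1 hn
    rw [← sub_mul, norm_mul, ← Complex.ofReal_sub, Complex.norm_real, Real.norm_of_nonneg]
    · have : Real.log n ≤ Real.log N := Real.log_le_log (by exact_mod_cast h1) (by exact_mod_cast h2)
      exact mul_le_of_le_one_right (by linarith) (hf _)
    · have : Real.log n ≤ Real.log N := Real.log_le_log (by exact_mod_cast h1) (by exact_mod_cast h2)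
      linarith
  have e3 := hC₁ f hf N
  have e4 : ‖∑ m ∈ Icc 1 N, (Chebyshev.psi ((N : ℝ) / m) : ℂ) * f (bigOmega m + 1) -
      ((N * harmonicSum N : ℝ) : ℂ) * L‖ ≤ ε / 2 * (N * harmonicSum N) + C₂ * N := by
    have : ((N * harmonicSum N : ℝ) : ℂ) * L =
        ∑ m ∈ Icc 1 N, (((N : ℝ) / m : ℝ) : ℂ) * f (bigOmega m + 1) := by
      rw [hL, logAvg, Complex.real_smul, mul_sum, mul_sum]
      refine sum_congr rfl fun m _ => ?_
      have : (harmonicSum N : ℂ) ≠ 0 := by exact_mod_cast hH0.ne'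
      rw [Complex.real_smul]
      push_cast
      field_simp
    rw [this, ← sum_sub_distrib]
    refine (norm_sum_le _ _).trans ?_
    calc _ ≤ ∑ m ∈ Icc 1 N, (ε / 2 * ((N : ℝ) * (m : ℝ)⁻¹) + C₂) := by
          refine sum_le_sum fun m _ => ?_
          rw [← sub_mul, norm_mul, ← Complex.ofReal_sub, Complex.norm_real, Real.norm_eq_abs]
          refine (mul_le_of_le_one_right (abs_nonneg _) (hf _)).trans ?_
          exact hψ _ (by positivity)
      _ = _ := by
          rw [sum_add_distrib, ← mul_sum, ← mul_sum, harmonicSum]; simp; ring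
  have e5 : ‖(harmonicSum N : ℂ) * S - ((N * harmonicSum N : ℝ) : ℂ) * L‖ ≤
      ε / 2 * (N * harmonicSum N) + (2 + C₁ + C₂) * N := by
    have := (norm_add_le _ _).trans (add_le_add (norm_add₃_le.trans
      (add_le_add (add_le_add e1 e2) e3)) e4)
    refine le_trans (le_of_eq ?_) (this.trans (by linarith))
    congr 1
    push_cast
    ring
  have e6 : (N : ℂ)⁻¹ * S - L = ((N * harmonicSum N : ℝ) : ℂ)⁻¹ *
      ((harmonicSum N : ℂ) * S - ((N * harmonicSum N : ℝ) : ℂ) * L) := by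
    have h1 : (harmonicSum N : ℂ) ≠ 0 := by exact_mod_cast hH0.ne'
    have h2 : (N : ℂ) ≠ 0 := by exact_mod_cast hN0.ne'
    push_cast
    field_simp
  rw [e6, norm_mul, norm_inv, Complex.norm_real, Real.norm_of_nonneg (by positivity),
    inv_mul_lt_iff₀ (by positivity)]
  refine e5.trans_lt ?_
  rw [div_lt_iff₀ (by positivity)] at hH
  nlinarith

end LogAverage

section Stein

/-- The sum of the reciprocals of the primes up to `N`. -/
noncomputable def primeSum (N : ℕ) : ℝ := ∑ p ∈ Icc 1 N with p.Prime, (p : ℝ)⁻¹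

theorem primeSum_nonneg (N : ℕ) : 0 ≤ primeSum N := sum_nonneg fun _ _ => by positivity

theorem tendsto_primeSum : Tendsto primeSum atTop atTop := by
  have h := not_summable_one_div_on_primes
  rw [not_summable_iff_tendsto_nat_atTop_of_nonneg
    fun n => Set.indicator_nonneg (fun _ _ => by positivity) n] at h
  refine ((tendsto_add_atTop_iff_nat 1).2 h).congr fun N => ?_
  rw [primeSum, sum_filter, range_eq_Ico, sum_eq_sum_Ico_succ_bot (by omega)]
  simp [Set.indicator_apply, Ico_add_one_right_eq_Icc]

theorem sum_log_div_prime_le {N : ℕ} (hN : 1 ≤ N) :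
    ∑ p ∈ Icc 1 N with p.Prime, Real.log p / p ≤ Real.log N + Real.log 4 := by
  have hN0 : (0 : ℝ) < N := by exact_mod_cast hN
  have h1 : ∑ n ∈ Icc 1 N, Real.log n =
      ∑ q ∈ Icc 1 N, ArithmeticFunction.vonMangoldt q * (N / q : ℕ) := by
    have := sum_Icc_sum_divisorsAntidiagonal N (fun q _ => ArithmeticFunction.vonMangoldt q)
    simp only [sum_const, Nat.card_Icc, add_tsub_cancel_right, nsmul_eq_mul] at this
    simp only [mul_comm]
    rw [← this]
    refine sum_congr rfl fun n _ => ?_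
    rw [← ArithmeticFunction.vonMangoldt_sum, ← Nat.sum_divisorsAntidiagonal
      (fun q _ => ArithmeticFunction.vonMangoldt q)]
  have h2 : ∑ n ∈ Icc 1 N, Real.log n ≤ N * Real.log N := by
    refine (sum_le_sum fun n hn => ?_).trans (by simp : ∑ n ∈ Icc 1 N, Real.log N ≤ N * Real.log N)
    obtain ⟨h1, h2⟩ := mem_Icc.1 hn
    exact Real.log_le_log (by exact_mod_cast h1) (by exact_mod_cast h2)
  have h3 : ∑ p ∈ Icc 1 N with p.Prime, (N * (Real.log p / p) - Real.log p) ≤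
      ∑ q ∈ Icc 1 N, ArithmeticFunction.vonMangoldt q * (N / q : ℕ) := by
    rw [sum_filter]
    refine sum_le_sum fun q hq => ?_
    split_ifs with h
    · rw [ArithmeticFunction.vonMangoldt_apply_prime h]
      have h5 : (N : ℝ) / q ≤ (N / q : ℕ) + 1 := by
        rw [← Nat.floor_div_eq_div (K := ℝ)]
        exact (Nat.lt_floor_add_one _).le
      have h6 : 0 ≤ Real.log q := Real.log_natCast_nonneg q
      have := mul_le_mul_of_nonneg_left h5 h6
      rw [mul_add] at this
      have e : (N : ℝ) * (Real.log q / q) = Real.log q * (N / q) := by ring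
      linarith
    · exact mul_nonneg ArithmeticFunction.vonMangoldt_nonneg (by positivity)
  have h4 : ∑ p ∈ Icc 1 N with p.Prime, Real.log p ≤ Real.log 4 * N := by
    have := Chebyshev.theta_le_log4_mul_x (x := N) (by positivity)
    rw [Chebyshev.theta, Nat.floor_natCast] at this
    exact this
  rw [sum_sub_distrib, ← mul_sum] at h3
  refine le_of_mul_le_mul_left ?_ hN0
  linarith

theorem sum_smul_smallOmega {E : Type*} [NormedAddCommGroup E] [NormedSpace ℝ E]
    (N : ℕ) (G : ℕ → E) :
    ∑ n ∈ Icc 1 N, (n : ℝ)⁻¹ • (smallOmega n : ℝ) • G n =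
      ∑ m ∈ Icc 1 N, ∑ q ∈ Icc 1 (N / m) with q.Prime,
        ((m : ℝ)⁻¹ * (q : ℝ)⁻¹) • G (m * q) := by
  simp only [sum_filter]
  rw [← sum_Icc_sum_divisorsAntidiagonal N
    (fun m q => if q.Prime then ((m : ℝ)⁻¹ * (q : ℝ)⁻¹) • G (m * q) else 0)]
  refine sum_congr rfl fun n hn => ?_
  have hn0 : n ≠ 0 := by have := (mem_Icc.1 hn).1; omega
  have : ∀ x ∈ n.divisorsAntidiagonal, (if x.2.Prime then
      ((x.1 : ℝ)⁻¹ * (x.2 : ℝ)⁻¹) • G (x.1 * x.2) else 0) =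
      if x.2.Prime then (n : ℝ)⁻¹ • G n else 0 := by
    intro x hx
    rw [← (Nat.mem_divisorsAntidiagonal.1 hx).1]
    push_cast
    rw [mul_inv]
  rw [sum_congr rfl this, Nat.sum_divisorsAntidiagonal'
    (fun _ q => if q.Prime then (n : ℝ)⁻¹ • G n else 0), ← sum_filter, sum_const, smul_comm,
    ← Nat.cast_smul_eq_nsmul ℝ]
  congr 3
  rw [smallOmega]
  congr 1
  ext p
  simp [hn0, and_comm]

theorem logAvg_smallOmega_smul_eq {E : Type*} [NormedAddCommGroup E] [NormedSpace ℝ E]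
    (N : ℕ) (G : ℕ → E) :
    logAvg N (fun n => (smallOmega n : ℝ) • G n) = (harmonicSum N)⁻¹ •
      ∑ m ∈ Icc 1 N, ∑ q ∈ Icc 1 (N / m) with q.Prime, ((m : ℝ)⁻¹ * (q : ℝ)⁻¹) • G (m * q) := by
  rw [logAvg, sum_smul_smallOmega]

theorem sum_inv_gt_le {N q : ℕ} (hq : 1 ≤ q) :
    ∑ m ∈ Icc 1 N with N < m * q, (m : ℝ)⁻¹ ≤ 1 + Real.log q := by
  rcases N.eq_zero_or_pos with rfl | hN
  · simp; linarith [Real.log_natCast_nonneg q]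
  have h1 : ∑ m ∈ Icc 1 N with N < m * q, (m : ℝ)⁻¹ + harmonicSum (N / q) = harmonicSum N := by
    rw [harmonicSum, harmonicSum, ← sum_filter_add_sum_filter_not (Icc 1 N) (fun m => N < m * q)]
    congr 2
    ext m
    simp only [mem_Icc, mem_filter, not_lt, Nat.le_div_iff_mul_le hq]
    constructor
    · rintro ⟨h1, h2⟩
      exact ⟨⟨h1, (Nat.le_mul_of_pos_right m hq).trans h2⟩, h2⟩
    · rintro ⟨⟨h1, -⟩, h2⟩
      exact ⟨h1, h2⟩
  have h2 := log_add_one_le_harmonic (N / q)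
  rw [← harmonicSum_eq] at h2
  have h3 := harmonicSum_le N
  have hq0 : (0 : ℝ) < q := by exact_mod_cast hq
  have hN0 : (0 : ℝ) < N := by exact_mod_cast hN
  have h4 : Real.log (N / q) ≤ Real.log (N / q + 1 : ℕ) := by
    refine Real.log_le_log (by positivity) ?_
    push_cast
    rw [← Nat.floor_div_eq_div (K := ℝ)]
    exact (Nat.lt_floor_add_one _).le
  rw [Real.log_div hN0.ne' hq0.ne'] at h4
  linarith

theorem sum_prime_truncation_le {N : ℕ} (hN : 1 ≤ N) :
    ∑ m ∈ Icc 1 N, ∑ q ∈ Icc 1 N with q.Prime ∧ N < m * q, (m : ℝ)⁻¹ * (q : ℝ)⁻¹ ≤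
      9 * harmonicSum N := by
  calc ∑ m ∈ Icc 1 N, ∑ q ∈ Icc 1 N with q.Prime ∧ N < m * q, (m : ℝ)⁻¹ * (q : ℝ)⁻¹
      = ∑ q ∈ Icc 1 N with q.Prime, (q : ℝ)⁻¹ * ∑ m ∈ Icc 1 N with N < m * q, (m : ℝ)⁻¹ := by
        simp only [sum_filter, mul_sum]
        rw [sum_comm]
        refine sum_congr rfl fun q _ => ?_
        by_cases h : q.Prime
        · simp [h, mul_comm]
        · simp [h]
    _ ≤ ∑ q ∈ Icc 1 N with q.Prime, 3 * (Real.log q / q) := by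
        refine sum_le_sum fun q hq => ?_
        have hq' := (mem_filter.1 hq).2
        refine (mul_le_mul_of_nonneg_left (sum_inv_gt_le hq'.one_lt.le) (by positivity)).trans ?_
        have h1 : Real.log 2 ≤ Real.log q :=
          Real.log_le_log (by norm_num) (by exact_mod_cast hq'.two_le)
        have h2 := Real.log_two_gt_d9
        rw [div_eq_mul_inv, mul_comm, ← mul_assoc]
        gcongr
        linarith
    _ ≤ 9 * harmonicSum N := by
        rw [← mul_sum]
        have h1 := sum_log_div_prime_le hN
        have h2 : Real.log 4 = 2 * Real.log 2 := by
          rw [show (4 : ℝ) = 2 ^ 2 by norm_num, Real.log_pow]; norm_num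
        have h3 := Real.log_two_lt_d9
        have h4 := one_le_harmonicSum hN
        have h5 := log_le_harmonicSum N
        linarith

variable {E : Type*} [NormedAddCommGroup E] [NormedSpace ℝ E]

theorem norm_sum_prime_sub_le {N : ℕ} (hN : 1 ≤ N) {G : ℕ → E} {B : ℝ} (hG : ∀ n, ‖G n‖ ≤ B) :
    ‖(harmonicSum N)⁻¹ • ∑ m ∈ Icc 1 N, ∑ q ∈ Icc 1 (N / m) with q.Prime,
      ((m : ℝ)⁻¹ * (q : ℝ)⁻¹) • G m - primeSum N • logAvg N G‖ ≤ 9 * B := by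
  have hH := one_le_harmonicSum hN
  have h1 : primeSum N • logAvg N G = (harmonicSum N)⁻¹ • ∑ m ∈ Icc 1 N,
      ∑ q ∈ Icc 1 N with q.Prime, ((m : ℝ)⁻¹ * (q : ℝ)⁻¹) • G m := by
    rw [logAvg, smul_comm]
    congr 1
    rw [smul_sum]
    refine sum_congr rfl fun m _ => ?_
    rw [← sum_smul, ← mul_sum, smul_smul, mul_comm, primeSum]
  rw [h1, ← smul_sub, norm_smul, norm_inv, Real.norm_of_nonneg (by linarith),
    inv_mul_le_iff₀ (by linarith), ← sum_sub_distrib]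
  have hB : 0 ≤ B := (norm_nonneg _).trans (hG 0)
  calc _ ≤ ∑ m ∈ Icc 1 N, ∑ q ∈ Icc 1 N with q.Prime ∧ N < m * q,
        ((m : ℝ)⁻¹ * (q : ℝ)⁻¹) * B := by
        refine (norm_sum_le _ _).trans (sum_le_sum fun m hm => ?_)
        have hm1 := (mem_Icc.1 hm).1
        have h2 : ∑ q ∈ Icc 1 N with q.Prime, ((m : ℝ)⁻¹ * (q : ℝ)⁻¹) • G m =
            ∑ q ∈ Icc 1 (N / m) with q.Prime, ((m : ℝ)⁻¹ * (q : ℝ)⁻¹) • G m +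
            ∑ q ∈ Icc 1 N with q.Prime ∧ N < m * q, ((m : ℝ)⁻¹ * (q : ℝ)⁻¹) • G m := by
          rw [← sum_filter_not_add_sum_filter _ (fun q => N < m * q), filter_filter, filter_filter]
          congr 2
          ext q
          simp only [mem_filter, mem_Icc, Nat.le_div_iff_mul_le hm1, not_lt]
          constructor
          · rintro ⟨⟨a, b⟩, c, d⟩
            exact ⟨⟨a, by rwa [mul_comm]⟩, c⟩
          · rintro ⟨⟨a, b⟩, c⟩
            exact ⟨⟨a, (Nat.le_mul_of_pos_right q hm1).trans b⟩, c, by rwa [mul_comm]⟩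
        rw [h2, sub_add_cancel_left, norm_neg]
        refine (norm_sum_le _ _).trans (sum_le_sum fun q _ => ?_)
        rw [norm_smul, Real.norm_of_nonneg (by positivity)]
        gcongr
        exact hG m
    _ ≤ harmonicSum N * (9 * B) := by
        simp only [← sum_mul]
        have := mul_le_mul_of_nonneg_right (sum_prime_truncation_le hN) hB
        linarith

theorem sum_inv_dvd_le {d : ℕ} (hd : 1 ≤ d) (N : ℕ) :
    ∑ n ∈ Icc 1 N with d ∣ n, (n : ℝ)⁻¹ ≤ harmonicSum N * (d : ℝ)⁻¹ := by
  calc ∑ n ∈ Icc 1 N with d ∣ n, (n : ℝ)⁻¹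
      = ∑ n ∈ Icc 1 N, ∑ x ∈ n.divisorsAntidiagonal,
          if x.2 = d then (x.1 : ℝ)⁻¹ * (d : ℝ)⁻¹ else 0 := by
        rw [sum_filter]
        refine sum_congr rfl fun n hn => ?_
        have hn0 : n ≠ 0 := by have := (mem_Icc.1 hn).1; omega
        have : ∀ x ∈ n.divisorsAntidiagonal, (if x.2 = d then (x.1 : ℝ)⁻¹ * (d : ℝ)⁻¹ else 0) =
            if x.2 = d then (n : ℝ)⁻¹ else 0 := by
          intro x hx
          split_ifs with h
          · rw [← (Nat.mem_divisorsAntidiagonal.1 hx).1, h]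
            push_cast
            rw [mul_inv]
          · rfl
        rw [sum_congr rfl this, Nat.sum_divisorsAntidiagonal'
          (fun _ q => if q = d then (n : ℝ)⁻¹ else 0), sum_ite_eq']
        simp [hn0]
    _ = ∑ m ∈ Icc 1 N, ∑ q ∈ Icc 1 (N / m), if q = d then (m : ℝ)⁻¹ * (d : ℝ)⁻¹ else 0 :=
        sum_Icc_sum_divisorsAntidiagonal N
          (fun m q => if q = d then (m : ℝ)⁻¹ * (d : ℝ)⁻¹ else 0)
    _ ≤ ∑ m ∈ Icc 1 N, (m : ℝ)⁻¹ * (d : ℝ)⁻¹ := by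
        refine sum_le_sum fun m _ => ?_
        rw [sum_ite_eq']
        split_ifs
        · rfl
        · positivity
    _ = harmonicSum N * (d : ℝ)⁻¹ := by rw [← sum_mul, harmonicSum]

theorem smallOmega_le_bigOmega (n : ℕ) : smallOmega n ≤ bigOmega n :=
  List.toFinset_card_le _

theorem bigOmega_sub_smallOmega_le {n N : ℕ} (hn : n ∈ Icc 1 N) :
    (bigOmega n : ℝ) - smallOmega n ≤
      ∑ p ∈ Icc 2 N, ∑ i ∈ Icc 2 N, if p ^ i ∣ n then 1 else 0 := by
  obtain ⟨hn1, hnN⟩ := mem_Icc.1 hn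
  have h1 : bigOmega n = ∑ p ∈ n.primeFactors, n.factorization p := by
    have := ArithmeticFunction.cardFactors_eq_sum_factorization (n := n)
    rwa [ArithmeticFunction.cardFactors_apply] at this
  have h2 : ∀ p ∈ n.primeFactors, (n.factorization p : ℝ) - 1 ≤
      ∑ i ∈ Icc 2 N, if p ^ i ∣ n then 1 else 0 := by
    intro p hp
    have hpp := Nat.prime_of_mem_primeFactors hp
    rw [Nat.factorization_eq_card_pow_dvd_of_lt hpp hn1
      ((hnN.trans_lt (Nat.lt_succ_self N)).trans (Nat.lt_pow_self hpp.one_lt)),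
      ← sum_boole, sum_eq_sum_Ico_succ_bot (by omega), pow_one,
      if_pos (Nat.dvd_of_mem_primeFactors hp), Nat.succ_eq_add_one, Ico_add_one_right_eq_Icc]
    simp
  rw [h1, smallOmega]
  push_cast
  calc _ = ∑ p ∈ n.primeFactors, ((n.factorization p : ℝ) - 1) := by simp
    _ ≤ ∑ p ∈ n.primeFactors, ∑ i ∈ Icc 2 N, if p ^ i ∣ n then (1 : ℝ) else 0 := sum_le_sum h2
    _ ≤ _ := by
      refine sum_le_sum_of_subset_of_nonneg (fun p hp => ?_)
        fun p _ _ => sum_nonneg fun i _ => by split_ifs <;> simp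
      exact mem_Icc.2 ⟨(Nat.prime_of_mem_primeFactors hp).two_le,
        (Nat.le_of_dvd hn1 (Nat.dvd_of_mem_primeFactors hp)).trans hnN⟩

theorem sum_Icc_two_inv_pow_le {p : ℕ} (hp : 2 ≤ p) (N : ℕ) :
    ∑ i ∈ Icc 2 N, ((p : ℝ) ^ i)⁻¹ ≤ ((p - 1 : ℝ))⁻¹ - (p : ℝ)⁻¹ := by
  have hp' : (2 : ℝ) ≤ p := by exact_mod_cast hp
  suffices h : ∀ N : ℕ, ∑ i ∈ Icc 2 (N + 1), ((p : ℝ) ^ i)⁻¹ =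
      ((p - 1 : ℝ))⁻¹ - (p : ℝ)⁻¹ - ((p - 1 : ℝ))⁻¹ * ((p : ℝ) ^ (N + 1))⁻¹ by
    rcases N with _ | N
    · simp only [show Icc 2 0 = (∅ : Finset ℕ) by rfl, sum_empty]
      rw [sub_nonneg]
      gcongr <;> linarith
    · rw [h N]
      have : 0 ≤ ((p - 1 : ℝ))⁻¹ * ((p : ℝ) ^ (N + 1))⁻¹ :=
        mul_nonneg (inv_nonneg.2 (by linarith)) (by positivity)
      linarith
  intro N
  have h1 : (p - 1 : ℝ) ≠ 0 := by linarith
  have h2 : (p : ℝ) ≠ 0 := by linarith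
  induction N with
  | zero =>
    simp only [zero_add, show Icc 2 1 = (∅ : Finset ℕ) by rfl, sum_empty]
    field_simp
    ring
  | succ n ih =>
    rw [sum_Icc_succ_top (by omega), ih]
    field_simp
    ring

theorem sum_Icc_two_telescope_le (N : ℕ) :
    ∑ p ∈ Icc 2 N, (((p - 1 : ℝ))⁻¹ - (p : ℝ)⁻¹) ≤ 1 := by
  suffices h : ∀ N : ℕ, ∑ p ∈ Icc 2 (N + 1), (((p - 1 : ℝ))⁻¹ - (p : ℝ)⁻¹) =
      1 - ((N + 1 : ℕ) : ℝ)⁻¹ by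
    rcases N with _ | N
    · simp
    · rw [h N]
      have : 0 ≤ ((N + 1 : ℕ) : ℝ)⁻¹ := by positivity
      linarith
  intro N
  induction N with
  | zero => simp
  | succ n ih =>
    rw [sum_Icc_succ_top (by omega), ih]
    push_cast
    ring

theorem logAvg_bigOmega_sub_smallOmega_le {N : ℕ} (hN : 1 ≤ N) :
    logAvg N (fun n => (bigOmega n : ℝ) - smallOmega n) ≤ 1 := by
  have hH := one_le_harmonicSum hN
  refine (logAvg_mono fun n hn => bigOmega_sub_smallOmega_le hn).trans ?_
  rw [logAvg_sum]
  refine le_trans (sum_le_sum fun p hp => ?_) (sum_Icc_two_telescope_le N)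
  rw [logAvg_sum]
  refine le_trans (sum_le_sum fun i _ => ?_) (sum_Icc_two_inv_pow_le (mem_Icc.1 hp).1 N)
  have hp1 : 1 ≤ p ^ i := Nat.one_le_pow _ _ (by have := (mem_Icc.1 hp).1; omega)
  have := sum_inv_dvd_le hp1 N
  rw [logAvg, smul_eq_mul, inv_mul_le_iff₀ (by linarith)]
  rw [sum_filter] at this
  push_cast at this
  refine le_trans (le_of_eq (sum_congr rfl fun n _ => ?_)) this
  simp

theorem abs_logAvg_smallOmega_sub_le {N : ℕ} (hN : 1 ≤ N) :
    |logAvg N (fun n => (smallOmega n : ℝ)) - primeSum N| ≤ 9 := by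
  have h := norm_sum_prime_sub_le (G := fun _ => (1 : ℝ)) hN (B := 1) (by simp)
  have h2 := logAvg_smallOmega_smul_eq N (fun _ => (1 : ℝ))
  rw [← h2, logAvg_const hN] at h
  simpa using h

theorem smallOmega_mul_prime_le {m q : ℕ} (hm : m ≠ 0) (hq : q.Prime) :
    smallOmega (m * q) ≤ smallOmega m + 1 := by
  rw [smallOmega, smallOmega, Nat.primeFactors_mul hm hq.ne_zero, hq.primeFactors]
  exact card_union_le _ _

theorem logAvg_smallOmega_le {N : ℕ} (hN : 1 ≤ N) :
    logAvg N (fun n => (smallOmega n : ℝ)) ≤ primeSum N := by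
  have hH := one_le_harmonicSum hN
  have h2 := logAvg_smallOmega_smul_eq N (fun _ => (1 : ℝ))
  simp only [smul_eq_mul, mul_one] at h2
  rw [h2, inv_mul_le_iff₀ (by linarith), harmonicSum, sum_mul]
  refine sum_le_sum fun m _ => ?_
  rw [← mul_sum, primeSum]
  refine mul_le_mul_of_nonneg_left (sum_le_sum_of_subset_of_nonneg ?_ fun _ _ _ => by positivity)
    (by positivity)
  exact filter_subset_filter _ (Icc_subset_Icc_right (Nat.div_le_self _ _))

theorem logAvg_smallOmega_sq_le {N : ℕ} (hN : 1 ≤ N) :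
    logAvg N (fun n => (smallOmega n : ℝ) ^ 2) ≤ primeSum N * (primeSum N + 1) := by
  have hH := one_le_harmonicSum hN
  have h2 := logAvg_smallOmega_smul_eq N (fun n => (smallOmega n : ℝ))
  simp only [smul_eq_mul, ← sq] at h2
  have h3 : logAvg N (fun n => (smallOmega n : ℝ) + 1) ≤ primeSum N + 1 := by
    rw [logAvg_add, logAvg_const hN]
    linarith [logAvg_smallOmega_le hN]
  refine le_trans ?_ (mul_le_mul_of_nonneg_left h3 (primeSum_nonneg N))
  rw [h2, logAvg, smul_eq_mul, mul_left_comm]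
  refine mul_le_mul_of_nonneg_left ?_ (by positivity)
  rw [mul_sum]
  refine sum_le_sum fun m hm => ?_
  have hm0 : m ≠ 0 := by have := (mem_Icc.1 hm).1; omega
  rw [primeSum, sum_mul]
  refine (sum_le_sum fun q hq => ?_).trans (sum_le_sum_of_subset_of_nonneg
    (filter_subset_filter _ (Icc_subset_Icc_right (Nat.div_le_self _ _)))
    fun _ _ _ => by simp only [smul_eq_mul]; positivity)
  have : (smallOmega (m * q) : ℝ) ≤ smallOmega m + 1 := by
    exact_mod_cast smallOmega_mul_prime_le hm0 (mem_filter.1 hq).2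
  rw [smul_eq_mul, ← mul_assoc, mul_comm (q : ℝ)⁻¹]
  gcongr

/-- Concentration of `Ω` around `∑_{p ≤ N} 1/p` in logarithmic mean. -/
theorem logAvg_abs_bigOmega_sub_le {N : ℕ} (hN : 1 ≤ N) (hl : 1 ≤ primeSum N) :
    logAvg N (fun n => |(bigOmega n : ℝ) - primeSum N|) ≤ 11 * Real.sqrt (primeSum N) := by
  set l := primeSum N with hldef
  have hs1 : 1 ≤ Real.sqrt l := Real.one_le_sqrt.2 hl
  have hs2 := Real.mul_self_sqrt (show 0 ≤ l by linarith)
  set s := Real.sqrt l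
  have h1 : logAvg N (fun n => ((smallOmega n : ℝ) - l) ^ 2) ≤ 19 * l := by
    have : (fun n => ((smallOmega n : ℝ) - l) ^ 2) = fun n =>
        ((smallOmega n : ℝ) ^ 2 - (2 * l) * smallOmega n) + l ^ 2 := by
      ext n; ring
    rw [this, logAvg_add, logAvg_sub, logAvg_const_mul, logAvg_const hN]
    have e1 := logAvg_smallOmega_sq_le hN
    have e2 := (abs_le.1 (abs_logAvg_smallOmega_sub_le hN)).1
    rw [← hldef] at e1 e2
    nlinarith
  have h2 : logAvg N (fun n => |(bigOmega n : ℝ) - l|) ≤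
      logAvg N (fun n => ((bigOmega n : ℝ) - smallOmega n) +
        ((1 / (2 * s)) * ((smallOmega n : ℝ) - l) ^ 2 + s / 2)) := by
    refine logAvg_mono fun n _ => ?_
    have e1 : (smallOmega n : ℝ) ≤ bigOmega n := by exact_mod_cast smallOmega_le_bigOmega n
    have e2 : |(smallOmega n : ℝ) - l| ≤ (1 / (2 * s)) * ((smallOmega n : ℝ) - l) ^ 2 + s / 2 := by
      rw [← sq_abs, ← sub_nonneg]
      have : (1 / (2 * s)) * |(smallOmega n : ℝ) - l| ^ 2 + s / 2 - |(smallOmega n : ℝ) - l| =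
        (1 / (2 * s)) * (|(smallOmega n : ℝ) - l| - s) ^ 2 := by field_simp; ring
      rw [this]; positivity
    have e3 := abs_add_le ((bigOmega n : ℝ) - smallOmega n) ((smallOmega n : ℝ) - l)
    rw [sub_add_sub_cancel, abs_of_nonneg (sub_nonneg.2 e1)] at e3
    linarith
  rw [logAvg_add, logAvg_add, logAvg_const_mul, logAvg_const hN] at h2
  have h3 := logAvg_bigOmega_sub_smallOmega_le hN
  have h4 : 1 / (2 * s) * logAvg N (fun n => ((smallOmega n : ℝ) - l) ^ 2) ≤ 19 / 2 * s := by
    rw [div_mul_eq_mul_div, one_mul, div_le_iff₀ (by positivity)]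
    nlinarith
  linarith

/-- An approximate Stein identity for `Ω` in logarithmic mean. -/
theorem norm_logAvg_bigOmega_smul_sub_le {N : ℕ} (hN : 1 ≤ N) {g : ℕ → E} {B : ℝ}
    (hg : ∀ k, ‖g k‖ ≤ B) :
    ‖logAvg N (fun n => (bigOmega n : ℝ) • g (bigOmega n)) -
      primeSum N • logAvg N (fun n => g (bigOmega n + 1))‖ ≤ 10 * B := by
  have hB : 0 ≤ B := (norm_nonneg _).trans (hg 0)
  have h1 : logAvg N (fun n => (bigOmega n : ℝ) • g (bigOmega n)) =
      logAvg N (fun n => ((bigOmega n : ℝ) - smallOmega n) • g (bigOmega n)) +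
      logAvg N (fun n => (smallOmega n : ℝ) • g (bigOmega n)) := by
    rw [← logAvg_add]
    congr 1; ext n
    rw [← add_smul, sub_add_cancel]
  have h2 : ‖logAvg N (fun n => ((bigOmega n : ℝ) - smallOmega n) • g (bigOmega n))‖ ≤ B := by
    refine (norm_logAvg_le_of_le (g := fun n => B * ((bigOmega n : ℝ) - smallOmega n))
      fun n _ => ?_).trans ?_
    · have e1 : (smallOmega n : ℝ) ≤ bigOmega n := by exact_mod_cast smallOmega_le_bigOmega n
      rw [norm_smul, Real.norm_of_nonneg (sub_nonneg.2 e1), mul_comm]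
      exact mul_le_mul_of_nonneg_right (hg _) (sub_nonneg.2 e1)
    · rw [logAvg_const_mul]
      exact mul_le_of_le_one_right hB (logAvg_bigOmega_sub_smallOmega_le hN)
  have h3 := norm_sum_prime_sub_le (G := fun n => g (bigOmega n + 1)) hN (fun n => hg _)
  have h4 : logAvg N (fun n => (smallOmega n : ℝ) • g (bigOmega n)) = (harmonicSum N)⁻¹ •
      ∑ m ∈ Icc 1 N, ∑ q ∈ Icc 1 (N / m) with q.Prime,
        ((m : ℝ)⁻¹ * (q : ℝ)⁻¹) • g (bigOmega m + 1) := by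
    rw [logAvg_smallOmega_smul_eq N (fun n => g (bigOmega n))]
    congr 1
    refine sum_congr rfl fun m hm => sum_congr rfl fun q hq => ?_
    rw [bigOmega_mul_prime (by have := (mem_Icc.1 hm).1; omega) (mem_filter.1 hq).2]
  rw [h1, h4, add_sub_assoc]
  refine (norm_add_le _ _).trans ?_
  linarith

theorem norm_logAvg_bigOmega_smul_sub_mul_le {N : ℕ} (hN : 1 ≤ N) (hl : 1 ≤ primeSum N)
    {g : ℕ → E} {B : ℝ} (hg : ∀ k, ‖g k‖ ≤ B) :
    ‖logAvg N (fun n => (bigOmega n : ℝ) • g (bigOmega n)) -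
      primeSum N • logAvg N (fun n => g (bigOmega n))‖ ≤ 11 * B * Real.sqrt (primeSum N) := by
  have hB : 0 ≤ B := (norm_nonneg _).trans (hg 0)
  have : primeSum N • logAvg N (fun n => g (bigOmega n)) =
      logAvg N (fun n => primeSum N • g (bigOmega n)) := by
    simp only [logAvg, smul_sum]
    exact sum_congr rfl fun n _ => by
      rw [smul_comm (primeSum N) (harmonicSum N)⁻¹, smul_comm (primeSum N) (n : ℝ)⁻¹]
  rw [this, ← logAvg_sub]
  refine (norm_logAvg_le_of_le (g := fun n => B * |(bigOmega n : ℝ) - primeSum N|)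
    fun n _ => ?_).trans ?_
  · rw [← sub_smul, norm_smul, Real.norm_eq_abs, mul_comm]
    exact mul_le_mul_of_nonneg_right (hg _) (abs_nonneg _)
  · rw [logAvg_const_mul]
    nlinarith [logAvg_abs_bigOmega_sub_le hN hl]

/-- The law of `Ω` in logarithmic mean is almost invariant under shifts. -/
theorem norm_logAvg_sub_shift_le {N : ℕ} (hN : 1 ≤ N) (hl : 1 ≤ primeSum N)
    {g : ℕ → E} {B : ℝ} (hg : ∀ k, ‖g k‖ ≤ B) (j : ℕ) :
    ‖logAvg N (fun n => g (bigOmega n)) - logAvg N (fun n => g (bigOmega n + j))‖ ≤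
      j * (21 * B / Real.sqrt (primeSum N)) := by
  have hB : 0 ≤ B := (norm_nonneg _).trans (hg 0)
  have hs1 : 1 ≤ Real.sqrt (primeSum N) := Real.one_le_sqrt.2 hl
  have hs2 := Real.mul_self_sqrt (show 0 ≤ primeSum N by linarith)
  have key : ∀ {g : ℕ → E}, (∀ k, ‖g k‖ ≤ B) →
      ‖logAvg N (fun n => g (bigOmega n)) - logAvg N (fun n => g (bigOmega n + 1))‖ ≤
        21 * B / Real.sqrt (primeSum N) := by
    intro g hg
    have h1 := norm_logAvg_bigOmega_smul_sub_le hN hg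
    have h2 := norm_logAvg_bigOmega_smul_sub_mul_le hN hl hg
    have h3 := (norm_sub_le _ _).trans (add_le_add h1 h2)
    rw [sub_sub_sub_cancel_left, ← smul_sub, norm_smul,
      Real.norm_of_nonneg (primeSum_nonneg N)] at h3
    rw [le_div_iff₀ (by linarith)]
    have h4 := mul_le_mul_of_nonneg_right hs1 hB
    refine le_of_mul_le_mul_left ?_ (show 0 < Real.sqrt (primeSum N) by linarith)
    set s := Real.sqrt (primeSum N)
    rw [← hs2] at h3
    nlinarith
  induction j with
  | zero => simp
  | succ j ih =>
    have h1 := key (g := fun k => g (k + j)) fun k => hg _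
    have h2 := norm_add_le _ _ |>.trans (add_le_add ih h1)
    have e : (fun n => g (bigOmega n + 1 + j)) = fun n => g (bigOmega n + (j + 1)) := by
      ext n; congr 1; ring
    rw [e, sub_add_sub_cancel] at h2
    push_cast
    linarith

end Stein

section WeylSums

/-- The additive character `x ↦ exp (2πix)` of `ℝ`. -/
noncomputable def expTwoPi (x : ℝ) : ℂ := Complex.exp (Complex.I * ((2 * Real.pi * x : ℝ) : ℂ))

@[simp] theorem norm_expTwoPi (x : ℝ) : ‖expTwoPi x‖ = 1 := by
  rw [expTwoPi, mul_comm]; exact Complex.norm_exp_ofReal_mul_I _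

theorem expTwoPi_add (x y : ℝ) : expTwoPi (x + y) = expTwoPi x * expTwoPi y := by
  rw [expTwoPi, expTwoPi, expTwoPi, ← Complex.exp_add]; congr 1; push_cast; ring

theorem expTwoPi_sub (x y : ℝ) :
    expTwoPi (x - y) = expTwoPi x * (starRingEnd ℂ) (expTwoPi y) := by
  rw [expTwoPi, expTwoPi, expTwoPi, ← Complex.exp_conj, ← Complex.exp_add]
  congr 1
  rw [map_mul, Complex.conj_I, Complex.conj_ofReal]
  push_cast
  ring

@[simp] theorem expTwoPi_zero : expTwoPi 0 = 1 := by simp [expTwoPi]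

theorem norm_expTwoPi_sub_one_le (x : ℝ) : ‖expTwoPi x - 1‖ ≤ 2 * Real.pi * |x| := by
  have := Real.norm_exp_I_mul_ofReal_sub_one_le (x := 2 * Real.pi * x)
  rwa [Real.norm_eq_abs, abs_mul, abs_of_pos Real.two_pi_pos] at this

theorem norm_expTwoPi_sub_le (x y : ℝ) :
    ‖expTwoPi x - expTwoPi y‖ ≤ 2 * Real.pi * |x - y| := by
  have : expTwoPi x - expTwoPi y = expTwoPi y * (expTwoPi (x - y) - 1) := by
    rw [mul_sub, ← expTwoPi_add]; simp
  rw [this, norm_mul, norm_expTwoPi, one_mul]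
  exact norm_expTwoPi_sub_one_le _

theorem le_norm_expTwoPi_sub_one {x : ℝ} (hx : |x| ≤ 1 / 2) : 4 * |x| ≤ ‖expTwoPi x - 1‖ := by
  rw [expTwoPi, Complex.norm_exp_I_mul_ofReal_sub_one, Real.norm_eq_abs, abs_mul,
    abs_of_pos (two_pos : (0 : ℝ) < 2)]
  have h := Real.mul_abs_le_abs_sin (x := 2 * Real.pi * x / 2) (by
    rw [abs_div, abs_mul, abs_of_pos Real.two_pi_pos]
    have := Real.pi_pos
    simp
    nlinarith)
  rw [show 2 * Real.pi * x / 2 = Real.pi * x by ring] at *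
  rw [abs_mul, abs_of_pos Real.pi_pos] at h
  have : 2 / Real.pi * (Real.pi * |x|) = 2 * |x| := by field_simp
  linarith

/-- Sequences whose iterated differences behave like those of a polynomial of degree at most `d + 1`
with coefficient `α` in degree `d + 1`. -/
def IsPolyPhase : ℕ → ℝ → (ℕ → ℝ) → Prop
  | 0, α, φ => ∃ β, ∀ j, φ j = α * j + β
  | d + 1, α, φ => ∀ h : ℕ, IsPolyPhase d ((d + 2) * h * α) fun j => φ (j + h) - φ j

theorem IsPolyPhase.add {d : ℕ} {α β : ℝ} {φ ψ : ℕ → ℝ} (hφ : IsPolyPhase d α φ)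
    (hψ : IsPolyPhase d β ψ) : IsPolyPhase d (α + β) fun j => φ j + ψ j := by
  induction d generalizing α β φ ψ with
  | zero =>
    obtain ⟨a, ha⟩ := hφ
    obtain ⟨b, hb⟩ := hψ
    exact ⟨a + b, fun j => by simp only [ha, hb]; ring⟩
  | succ d ih =>
    intro h
    convert ih (hφ h) (hψ h) using 1
    · ring
    · ext j; ring

theorem IsPolyPhase.const_mul {d : ℕ} {α : ℝ} {φ : ℕ → ℝ} (hφ : IsPolyPhase d α φ) (a : ℝ) :
    IsPolyPhase d (a * α) fun j => a * φ j := by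
  induction d generalizing α φ with
  | zero =>
    obtain ⟨b, hb⟩ := hφ
    exact ⟨a * b, fun j => by simp only [hb]; ring⟩
  | succ d ih =>
    intro h
    convert ih (hφ h) using 1
    · ring
    · ext j; ring

theorem IsPolyPhase.zero (d : ℕ) : IsPolyPhase d 0 fun _ => 0 := by
  induction d with
  | zero => exact ⟨0, by simp⟩
  | succ d ih => intro h; simpa using ih

theorem IsPolyPhase.sum {ι : Type*} (s : Finset ι) {d : ℕ} {α : ι → ℝ} {φ : ι → ℕ → ℝ}
    (h : ∀ i ∈ s, IsPolyPhase d (α i) (φ i)) :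
    IsPolyPhase d (∑ i ∈ s, α i) fun j => ∑ i ∈ s, φ i j := by
  classical
  induction s using Finset.induction_on with
  | empty => simpa using IsPolyPhase.zero d
  | insert a s ha ih =>
    simp only [sum_insert ha]
    exact (h a (mem_insert_self a s)).add (ih fun i hi => h i (mem_insert_of_mem hi))

theorem isPolyPhase_pow {d i : ℕ} (hi : i ≤ d + 1) :
    IsPolyPhase d (if i = d + 1 then 1 else 0) fun j => (j : ℝ) ^ i := by
  induction d generalizing i with
  | zero =>
    interval_cases i
    · exact ⟨1, by simp⟩
    · exact ⟨0, by simp⟩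
  | succ d ih =>
    intro h
    have h1 := IsPolyPhase.sum (range i) (d := d) fun m hm =>
      (ih (i := m) (by have := mem_range.1 hm; omega)).const_mul ((h : ℝ) ^ (i - m) * i.choose m)
    convert h1 using 1
    · simp only [mul_ite, mul_one, mul_zero, sum_ite_eq', mem_range]
      by_cases hid : i = d + 1 + 1
      · subst hid
        simp
        ring
      · rw [if_neg hid, if_neg (by omega)]
    · ext j
      push_cast
      rw [add_pow, sum_range_succ]
      simp
      exact sum_congr rfl fun m _ => by ring

theorem norm_sum_range_sq_eq (z : ℕ → ℂ) (hz : ∀ j, ‖z j‖ = 1) (J : ℕ) :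
    ‖∑ j ∈ range J, z j‖ ^ 2 = J + 2 * (∑ h ∈ range J, ∑ j ∈ range (J - (h + 1)),
      z (j + (h + 1)) * (starRingEnd ℂ) (z j)).re := by
  induction J with
  | zero => simp
  | succ J ih =>
    have h1 : ∑ h ∈ range (J + 1), ∑ j ∈ range (J + 1 - (h + 1)),
        z (j + (h + 1)) * (starRingEnd ℂ) (z j) =
        ∑ h ∈ range J, ∑ j ∈ range (J - (h + 1)), z (j + (h + 1)) * (starRingEnd ℂ) (z j) +
        z J * (starRingEnd ℂ) (∑ j ∈ range J, z j) := by
      rw [sum_range_succ, map_sum, mul_sum, ← sum_range_reflect (fun j => z J * _) J,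
        ← sum_add_distrib]
      simp only [Nat.sub_self, Nat.add_sub_add_right, range_zero, sum_empty, add_zero]
      refine sum_congr rfl fun h hh => ?_
      have := mem_range.1 hh
      rw [show J - h = J - (h + 1) + 1 by omega, sum_range_succ,
        show J - (h + 1) + (h + 1) = J by omega, show J - 1 - h = J - (h + 1) by omega]
    rw [h1, sum_range_succ, ← Complex.normSq_eq_norm_sq, Complex.normSq_add,
      Complex.normSq_eq_norm_sq, Complex.normSq_eq_norm_sq, ih, hz]
    rw [Complex.add_re, show ((∑ j ∈ range J, z j) * (starRingEnd ℂ) (z J)).re =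
      (z J * (starRingEnd ℂ) (∑ j ∈ range J, z j)).re by simp [Complex.mul_re]; ring]
    push_cast
    ring

theorem norm_sum_expTwoPi_linear_le {α β : ℝ} (h0 : α ≠ 0) (h : |α| ≤ 1 / 2) (J : ℕ) :
    ‖∑ j ∈ range J, expTwoPi (α * j + β)‖ ≤ 1 / (2 * |α|) := by
  have h1 := le_norm_expTwoPi_sub_one h
  have h2 : 0 < |α| := abs_pos.2 h0
  have hne : expTwoPi α ≠ 1 := by
    intro h; rw [h] at h1; simp at h1; linarith
  have h3 : ∀ j : ℕ, expTwoPi (α * j + β) = expTwoPi α ^ j * expTwoPi β := by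
    intro j
    rw [expTwoPi_add]
    congr 1
    induction j with
    | zero => simp
    | succ n ih => rw [pow_succ, ← ih, ← expTwoPi_add]; congr 1; push_cast; ring
  simp only [h3]
  rw [← sum_mul, geom_sum_eq hne, norm_mul, norm_expTwoPi, mul_one, norm_div]
  have h4 : ‖expTwoPi α ^ J - 1‖ ≤ 2 := (norm_sub_le _ _).trans (by simp; norm_num)
  rw [div_le_div_iff₀ (by linarith) (by linarith)]
  nlinarith

/-- Weyl's inequality in qualitative form. -/
theorem exists_norm_sum_expTwoPi_le (d : ℕ) {ε : ℝ} (hε : 0 < ε) :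
    ∃ T : ℝ, 0 < T ∧ ∀ (J : ℕ) (α : ℝ) (φ : ℕ → ℝ), IsPolyPhase d α φ →
      T ≤ |α| * J ^ (d + 1) → |α| * J ^ d * (2 * (d + 1).factorial) ≤ 1 →
      ‖∑ j ∈ range J, expTwoPi (φ j)‖ ≤ ε * J := by
  induction d generalizing ε with
  | zero =>
    refine ⟨1 / (2 * ε), by positivity, fun J α φ ⟨β, hφ⟩ h1 h2 => ?_⟩
    simp only [hφ]
    simp at h1 h2
    have h0 : α ≠ 0 := by
      rintro rfl
      simp at h1
      have : 0 < ε⁻¹ := by positivity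
      linarith
    have hα := abs_pos.2 h0
    refine (norm_sum_expTwoPi_linear_le h0 (by linarith) J).trans ?_
    rw [div_le_iff₀ (by positivity)]
    have := mul_le_mul_of_nonneg_left h1 (show 0 ≤ 2 * ε by positivity)
    rw [show 2 * ε * (ε⁻¹ * 2⁻¹) = 1 by field_simp] at this
    linarith
  | succ d ih =>
    obtain ⟨T, hT, hW⟩ := ih (ε := ε ^ 2 / 8) (by positivity)
    set η := ε ^ 2 / 16 with hη
    have hη0 : 0 < η := by positivity
    refine ⟨max (T / η ^ (d + 2)) (4 / ε ^ 2), by positivity, fun J α φ hφ h1 h2 => ?_⟩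
    have hT1 := (le_max_left _ _).trans h1
    have hT2 := (le_max_right _ _).trans h1
    have hJ0 : (0 : ℝ) ≤ J := by positivity
    have hf : (1 : ℝ) ≤ (d + 1 + 1).factorial := by exact_mod_cast Nat.one_le_iff_ne_zero.2 (Nat.factorial_ne_zero _)
    have hJ : 4 / ε ^ 2 ≤ J := by
      have h3 : |α| * J ^ (d + 1) ≤ 1 := by
        have : 0 ≤ |α| * (J : ℝ) ^ (d + 1) := by positivity
        nlinarith
      refine hT2.trans ?_
      rw [pow_succ, ← mul_assoc]
      exact mul_le_of_le_one_left hJ0 h3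
    have hinner : ∀ h ∈ range J, ‖∑ j ∈ range (J - (h + 1)),
        expTwoPi (φ (j + (h + 1))) * (starRingEnd ℂ) (expTwoPi (φ j))‖ ≤
        (ε ^ 2 / 8 + η) * J + if ((h + 1 : ℕ) : ℝ) ≤ η * J then (J : ℝ) else 0 := by
      intro h hh
      have hhJ := mem_range.1 hh
      simp only [← expTwoPi_sub]
      have htriv : ‖∑ j ∈ range (J - (h + 1)), expTwoPi (φ (j + (h + 1)) - φ j)‖ ≤
          ((J - (h + 1) : ℕ) : ℝ) := by
        refine (norm_sum_le _ _).trans ?_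
        simp
      have hJ' : ((J - (h + 1) : ℕ) : ℝ) ≤ J := by exact_mod_cast Nat.sub_le _ _
      split_ifs with hs
      · have : 0 ≤ (ε ^ 2 / 8 + η) * J := by positivity
        linarith
      rw [add_zero, add_mul]
      push Not at hs
      rcases le_total ((J - (h + 1) : ℕ) : ℝ) (η * J) with hl | hl
      · have : 0 ≤ ε ^ 2 / 8 * J := by positivity
        linarith
      have hJhh : ((h + 1 : ℕ) : ℝ) ≤ J := by exact_mod_cast hhJ
      refine (hW (J - (h + 1)) _ _ (hφ (h + 1)) ?_ ?_).trans ?_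
      · rw [abs_mul, abs_mul, abs_of_nonneg (show (0 : ℝ) ≤ d + 2 by positivity), Nat.abs_cast]
        calc T ≤ η ^ (d + 2) * (|α| * J ^ (d + 1 + 1)) := by
              rw [div_le_iff₀ (by positivity)] at hT1; linarith
          _ = 1 * (η * J) * |α| * (η * J) ^ (d + 1) := by ring
          _ ≤ _ := by
            gcongr
            have : (0 : ℝ) ≤ d := by positivity
            linarith
      · rw [abs_mul, abs_mul, abs_of_nonneg (show (0 : ℝ) ≤ d + 2 by positivity), Nat.abs_cast]
        refine le_trans ?_ h2
        rw [Nat.factorial_succ (d + 1)]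
        calc (d + 2) * ((h + 1 : ℕ) : ℝ) * |α| * ((J - (h + 1) : ℕ) : ℝ) ^ d *
              (2 * ((d + 1).factorial : ℝ))
            ≤ (d + 2) * (J : ℝ) * |α| * (J : ℝ) ^ d * (2 * ((d + 1).factorial : ℝ)) := by gcongr
          _ = _ := by push_cast; ring
      · have : ε ^ 2 / 8 * ((J - (h + 1) : ℕ) : ℝ) ≤ ε ^ 2 / 8 * J := by gcongr
        have : 0 ≤ η * J := by positivity
        linarith
    have hcount : ∑ h ∈ range J, (if ((h + 1 : ℕ) : ℝ) ≤ η * J then (J : ℝ) else 0) ≤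
        η * J * J := by
      rw [← sum_filter, sum_const, nsmul_eq_mul]
      gcongr
      have hsub : ({h ∈ range J | ((h + 1 : ℕ) : ℝ) ≤ η * J}) ⊆ range ⌊η * J⌋₊ := by
        intro h hh
        rw [mem_range]
        exact Nat.le_floor (mem_filter.1 hh).2
      have := card_le_card hsub
      rw [card_range] at this
      exact (Nat.cast_le.2 this).trans (Nat.floor_le (by positivity))
    have hsq := norm_sum_range_sq_eq (fun j => expTwoPi (φ j)) (fun j => norm_expTwoPi _) J
    have hre := (Complex.re_le_norm _).trans ((norm_sum_le _ _).trans (sum_le_sum hinner))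
    rw [sum_add_distrib, sum_const, card_range, nsmul_eq_mul] at hre
    refine (sq_le_sq₀ (norm_nonneg _) (by positivity)).1 ?_
    rw [hsq, mul_pow]
    rw [div_le_iff₀ (by positivity)] at hJ
    have hJ2 := mul_le_mul_of_nonneg_right hJ hJ0
    have e : η * J * J = ε ^ 2 / 16 * J ^ 2 := by rw [hη]; ring
    have e2 : (J : ℝ) * ((ε ^ 2 / 8 + η) * J) = 3 * (ε ^ 2 / 16 * J ^ 2) := by rw [hη]; ring
    rw [e] at hcount
    rw [e2] at hre
    have e3 : (J : ℝ) * ε ^ 2 * J = ε ^ 2 * J ^ 2 := by ring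
    linarith

end WeylSums

section FractionalPowers

open Asymptotics Topology

theorem ringChoose_ne_zero {c : ℝ} (hc : ¬∃ m : ℤ, c = (m : ℝ)) (n : ℕ) : Ring.choose c n ≠ 0 := by
  have key : (descPochhammer ℤ n).smeval c ≠ 0 := by
    induction n with
    | zero => simp
    | succ n ih =>
      rw [descPochhammer_succ_right, Polynomial.smeval_mul]
      refine mul_ne_zero ih ?_
      rw [Polynomial.smeval_sub, Polynomial.smeval_X, Polynomial.smeval_natCast]
      intro h
      refine hc ⟨n, ?_⟩
      simp at h
      push_cast
      linarith
  rw [Ring.descPochhammer_eq_factorial_smul_choose] at key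
  exact right_ne_zero_of_smul key

theorem exists_abs_rpow_add_sub_sum_le (c : ℝ) (n : ℕ) :
    ∃ C > 0, ∃ r > 0, ∀ k > 0, ∀ x : ℝ, |x| ≤ r * k →
      |(k + x) ^ c - ∑ i ∈ range n, Ring.choose c i * k ^ (c - i) * x ^ i| ≤
        C * (k ^ (c - n) * |x| ^ n) := by
  have h := (Real.one_add_rpow_hasFPowerSeriesAt_zero (a := c)).isBigO_sub_partialSum_pow n
  obtain ⟨C, hC, h⟩ := h.exists_pos
  rw [isBigOWith_iff, Metric.eventually_nhds_iff] at h
  obtain ⟨r, hr, h⟩ := h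
  refine ⟨C, hC, min (r / 2) (1 / 2), by positivity, fun k hk x hx => ?_⟩
  have hxk : |x / k| ≤ min (r / 2) (1 / 2) := by
    rw [abs_div, abs_of_pos hk]; exact (div_le_iff₀ hk).2 hx
  have h1 := h (y := x / k) (by
    rw [dist_zero_right, Real.norm_eq_abs]
    linarith [hxk.trans (min_le_left _ _)])
  have hpos : 0 < 1 + x / k := by
    have := neg_abs_le (x / k)
    linarith [hxk.trans (min_le_right _ _)]
  simp only [FormalMultilinearSeries.partialSum, binomialSeries_apply, zero_add, norm_pow,
    Real.norm_eq_abs, List.ofFn_const, List.prod_replicate, smul_eq_mul] at h1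
  have e0 : (k + x) ^ c = k ^ c * (1 + x / k) ^ c := by
    rw [← Real.mul_rpow hk.le hpos.le]; congr 1; field_simp
  have e1 : ∀ i : ℕ, Ring.choose c i * k ^ (c - i) * x ^ i =
      k ^ c * (Ring.choose c i * (x / k) ^ i) := fun i => by
    rw [Real.rpow_sub hk, Real.rpow_natCast, div_pow]; ring
  rw [e0, sum_congr rfl fun i _ => e1 i, ← mul_sum, ← mul_sub, abs_mul,
    abs_of_pos (Real.rpow_pos_of_pos hk c)]
  refine (mul_le_mul_of_nonneg_left h1 (by positivity)).trans_eq ?_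
  rw [Real.rpow_sub hk, Real.rpow_natCast, abs_div, abs_of_pos hk, abs_of_nonneg (div_nonneg (abs_nonneg x) hk.le),
    div_pow]
  ring

theorem rpow_le_two_rpow_abs_mul {k l : ℝ} (e : ℝ) (hl : 0 < l) (h1 : l / 2 ≤ k) (h2 : k ≤ 2 * l) :
    k ^ e ≤ 2 ^ |e| * l ^ e := by
  have hk : 0 < k := by linarith
  rcases le_total 0 e with he | he
  · rw [abs_of_nonneg he, ← Real.mul_rpow two_pos.le hl.le]
    exact Real.rpow_le_rpow hk.le h2 he
  · rw [abs_of_nonpos he, Real.rpow_neg two_pos.le, ← Real.inv_rpow two_pos.le,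
      ← Real.mul_rpow (by norm_num) hl.le]
    exact Real.rpow_le_rpow_of_nonpos (by positivity) (by linarith) he

theorem exists_eventually_norm_sum_expTwoPi_rpow_le {c h ε : ℝ} (hc : 1 / 2 < c)
    (hc' : ¬∃ m : ℤ, c = (m : ℝ)) (hh : h ≠ 0) (hε : 0 < ε) :
    ∃ δ > 0, δ ≤ ε ∧ ∀ᶠ l : ℝ in atTop, ∀ k : ℕ, l / 2 ≤ k → k ≤ 2 * l →
      ‖∑ j ∈ range ⌊δ * √l⌋₊, expTwoPi (h * ((k : ℝ) + j) ^ c)‖ ≤ ε * ⌊δ * √l⌋₊ := by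
  obtain ⟨d, hd⟩ : ∃ d : ℕ, ⌈2 * c - 1⌉₊ = d + 1 :=
    Nat.exists_eq_succ_of_ne_zero (Nat.ceil_pos.2 (by linarith)).ne'
  have hd1 : 2 * c ≤ d + 2 := by
    have := Nat.le_ceil (2 * c - 1)
    rw [hd] at this; push_cast at this; linarith
  have hd2 : (d : ℝ) + 1 < 2 * c := by
    have := Nat.ceil_lt_add_one (a := 2 * c - 1) (by linarith)
    rw [hd] at this; push_cast at this; linarith
  obtain ⟨T, hT, hW⟩ := exists_norm_sum_expTwoPi_le d (half_pos hε)
  obtain ⟨C, hC, r, hr, hTay⟩ := exists_abs_rpow_add_sub_sum_le c (d + 2)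
  set e : ℝ := c - (d + 1 : ℕ) with he
  set A : ℝ := |h * Ring.choose c (d + 1)| with hA
  have hApos : 0 < A := abs_pos.2 (mul_ne_zero hh (ringChoose_ne_zero hc' _))
  set K₁ : ℝ := A * 2 ^ |e| * (2 * (d + 1).factorial) with hK₁
  set K₂ : ℝ := 2 * Real.pi * (|h| * (C * 2 ^ |c - (d + 2 : ℕ)|)) with hK₂
  have hK₁pos : 0 < K₁ := by positivity
  have hK₂pos : 0 < K₂ := by have := Real.pi_pos; have := abs_pos.2 hh; positivity
  refine ⟨min (min ε 1) (min K₁⁻¹ (ε / 2 / K₂)), by positivity,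
    (min_le_left _ _).trans (min_le_left _ _), ?_⟩
  set δ := min (min ε 1) (min K₁⁻¹ (ε / 2 / K₂)) with hδ
  have hδpos : 0 < δ := by positivity
  have hδ1 : δ ≤ 1 := (min_le_left _ _).trans (min_le_right _ _)
  have hδK : δ * K₁ ≤ 1 := by
    have : δ ≤ K₁⁻¹ := (min_le_right _ _).trans (min_le_left _ _)
    calc δ * K₁ ≤ K₁⁻¹ * K₁ := by gcongr
      _ = 1 := inv_mul_cancel₀ hK₁pos.ne'
  have hδK2 : δ * K₂ ≤ ε / 2 := by
    have : δ ≤ ε / 2 / K₂ := (min_le_right _ _).trans (min_le_right _ _)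
    exact (le_div_iff₀ hK₂pos).1 this
  clear_value δ
  -- the size conditions that hold for large `l`
  have ev1 : ∀ᶠ l : ℝ in atTop, T ≤ A * (2 ^ |e|)⁻¹ * (δ / 2) ^ (d + 1) * l ^ (c - (d + 1) / 2) :=
    ((tendsto_rpow_atTop (by linarith : 0 < c - (d + 1) / 2)).const_mul_atTop
      (by positivity)).eventually_ge_atTop T
  have ev2 : ∀ᶠ l : ℝ in atTop, K₁ * δ ^ d * l ^ (c - (d + 2) / 2) ≤ 1 := by
    rcases Nat.eq_zero_or_pos d with rfl | hdpos
    · have hc1 : c ≠ 1 := fun h1 => hc' ⟨1, by simpa using h1⟩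
      have hc2 : c < 1 := lt_of_le_of_ne (by simpa using hd1) hc1
      have := ((tendsto_rpow_neg_atTop (by linarith : 0 < 1 - c)).const_mul (K₁ * δ ^ 0))
      rw [mul_zero] at this
      filter_upwards [this.eventually_le_const one_pos] with l hl
      rwa [show c - ((0 : ℕ) + 2 : ℝ) / 2 = -(1 - c) by push_cast; ring]
    · filter_upwards [eventually_ge_atTop 1] with l hl
      have h1 : l ^ (c - (d + 2) / 2) ≤ 1 := Real.rpow_le_one_of_one_le_of_nonpos hl (by linarith)
      have h2 : δ ^ d ≤ δ := pow_le_of_le_one hδpos.le hδ1 hdpos.ne'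
      calc K₁ * δ ^ d * l ^ (c - (d + 2) / 2) ≤ K₁ * δ * 1 := by gcongr
        _ ≤ 1 := by linarith
  have ev3 : ∀ᶠ l : ℝ in atTop, 2 ≤ δ * √l :=
    (Real.tendsto_sqrt_atTop.const_mul_atTop hδpos).eventually_ge_atTop 2
  have ev4 : ∀ᶠ l : ℝ in atTop, 2 / r ≤ √l := Real.tendsto_sqrt_atTop.eventually_ge_atTop _
  filter_upwards [ev1, ev2, ev3, ev4, eventually_ge_atTop 1] with l h1 h2 h3 h4 h5 k hk1 hk2
  set J := ⌊δ * √l⌋₊ with hJ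
  have hl0 : 0 < l := by linarith
  have hk0 : (0 : ℝ) < k := by linarith
  have hsl : 0 < √l := Real.sqrt_pos.2 hl0
  have hss : √l * √l = l := Real.mul_self_sqrt hl0.le
  have hJle : (J : ℝ) ≤ δ * √l := Nat.floor_le (by positivity)
  have hJge : δ / 2 * √l ≤ J := by
    have := Nat.lt_floor_add_one (δ * √l)
    rw [← hJ] at this
    linarith
  have hpw : ∀ (a : ℝ) (m : ℕ), l ^ a * √l ^ m = l ^ (a + m / 2) := fun a m => by
    rw [Real.rpow_add hl0, Real.sqrt_eq_rpow, ← Real.rpow_mul_natCast hl0.le]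
    congr 2; ring
  set a : ℕ → ℝ := fun i => h * (Ring.choose c i * (k : ℝ) ^ (c - i)) with ha
  set φ : ℕ → ℝ := fun j => ∑ i ∈ range (d + 2), a i * (j : ℝ) ^ i with hφ
  have hphase : IsPolyPhase d (a (d + 1)) φ := by
    have := IsPolyPhase.sum (range (d + 2)) (d := d) fun i hi =>
      (isPolyPhase_pow (d := d) (i := i) (by have := mem_range.1 hi; omega)).const_mul (a i)
    simpa using this
  have habs : |a (d + 1)| = A * (k : ℝ) ^ e := by
    rw [ha, hA]
    simp only
    rw [← mul_assoc, abs_mul, abs_of_pos (Real.rpow_pos_of_pos hk0 _)]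
  have hlow : (2 ^ |e|)⁻¹ * l ^ e ≤ (k : ℝ) ^ e := by
    rw [inv_mul_le_iff₀ (by positivity)]
    exact rpow_le_two_rpow_abs_mul e hk0 (by linarith) (by linarith)
  have hup := rpow_le_two_rpow_abs_mul e hl0 hk1 hk2
  have hmain : ‖∑ j ∈ range J, expTwoPi (φ j)‖ ≤ ε / 2 * J := by
    refine hW J _ φ hphase (h1.trans ?_) (le_trans ?_ h2)
    · rw [habs]
      calc A * (2 ^ |e|)⁻¹ * (δ / 2) ^ (d + 1) * l ^ (c - (d + 1) / 2)
          = A * ((2 ^ |e|)⁻¹ * l ^ e) * (δ / 2 * √l) ^ (d + 1) := by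
            rw [mul_pow, show A * ((2 ^ |e|)⁻¹ * l ^ e) * ((δ / 2) ^ (d + 1) * √l ^ (d + 1)) =
              A * (2 ^ |e|)⁻¹ * (δ / 2) ^ (d + 1) * (l ^ e * √l ^ (d + 1)) by ring, hpw, he]
            congr 2; push_cast; ring
        _ ≤ A * (k : ℝ) ^ e * (J : ℝ) ^ (d + 1) := by gcongr
    · rw [habs]
      calc A * (k : ℝ) ^ e * (J : ℝ) ^ d * (2 * (d + 1).factorial)
          ≤ A * (2 ^ |e| * l ^ e) * (δ * √l) ^ d * (2 * (d + 1).factorial) := by gcongr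
        _ = K₁ * δ ^ d * (l ^ e * √l ^ d) := by rw [hK₁, mul_pow]; ring
        _ = K₁ * δ ^ d * l ^ (c - (d + 2) / 2) := by
            rw [hpw, he]; congr 2; push_cast; ring
  have herr : ∀ j ∈ range J, ‖expTwoPi (h * ((k : ℝ) + j) ^ c) - expTwoPi (φ j)‖ ≤ ε / 2 := by
    intro j hj
    have hjJ : (j : ℝ) ≤ δ * √l := by
      have : (j : ℝ) ≤ J := by exact_mod_cast (mem_range.1 hj).le
      linarith
    refine (norm_expTwoPi_sub_le _ _).trans (le_trans ?_ hδK2)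
    have hφj : φ j = h * ∑ i ∈ range (d + 2), Ring.choose c i * (k : ℝ) ^ (c - i) * (j : ℝ) ^ i := by
      rw [hφ, mul_sum]
      exact sum_congr rfl fun i _ => by rw [ha]; ring
    have ht := hTay k hk0 j (by
      rw [Nat.abs_cast]
      calc (j : ℝ) ≤ 1 * √l := hjJ.trans (by gcongr)
        _ ≤ (√l * r / 2) * √l := by
          gcongr
          rw [div_le_iff₀ hr] at h4; linarith
        _ = r * (l / 2) := by linear_combination r / 2 * hss
        _ ≤ r * k := by gcongr)
    have hk3 := rpow_le_two_rpow_abs_mul (c - (d + 2 : ℕ)) hl0 hk1 hk2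
    rw [hφj, ← mul_sub, abs_mul]
    rw [Nat.abs_cast] at ht
    have hlast : (k : ℝ) ^ (c - (d + 2 : ℕ)) * (j : ℝ) ^ (d + 2) ≤ 2 ^ |c - (d + 2 : ℕ)| * δ := by
      calc (k : ℝ) ^ (c - (d + 2 : ℕ)) * (j : ℝ) ^ (d + 2)
          ≤ (2 ^ |c - (d + 2 : ℕ)| * l ^ (c - (d + 2 : ℕ))) * (δ * √l) ^ (d + 2) := by gcongr
        _ = 2 ^ |c - (d + 2 : ℕ)| * δ ^ (d + 2) * l ^ (c - (d + 2 : ℕ) + (d + 2 : ℕ) / 2) := by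
            rw [← hpw, mul_pow]; ring
        _ ≤ 2 ^ |c - (d + 2 : ℕ)| * δ * 1 := by
            gcongr
            · exact pow_le_of_le_one hδpos.le hδ1 (by omega)
            · exact Real.rpow_le_one_of_one_le_of_nonpos h5 (by push_cast; linarith)
        _ = _ := mul_one _
    calc 2 * Real.pi * (|h| * _) ≤ 2 * Real.pi * (|h| * (C * (2 ^ |c - (d + 2 : ℕ)| * δ))) := by
          have := Real.pi_pos
          gcongr
          exact ht.trans (by gcongr)
      _ = δ * K₂ := by rw [hK₂]; ring
  calc ‖∑ j ∈ range J, expTwoPi (h * ((k : ℝ) + j) ^ c)‖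
      = ‖∑ j ∈ range J, (expTwoPi (h * ((k : ℝ) + j) ^ c) - expTwoPi (φ j)) +
          ∑ j ∈ range J, expTwoPi (φ j)‖ := by rw [← sum_add_distrib]; simp
    _ ≤ ∑ j ∈ range J, ε / 2 + ε / 2 * J :=
        (norm_add_le _ _).trans (add_le_add (norm_sum_le_of_le _ herr) hmain)
    _ = ε * J := by simp; ring

end FractionalPowers

section WeylCriterion

open MeasureTheory Topology

theorem integral_fourier_unitAddCircle {k : ℤ} (hk : k ≠ 0) :
    ∫ t : UnitAddCircle, fourier k t = 0 := by
  have h := congrFun (fourierCoeff_fourier (T := 1) k) 0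
  rw [Pi.single_eq_of_ne hk.symm, fourierCoeff] at h
  rw [AddCircle.volume_eq_smul_haarAddCircle]
  simpa using h

theorem fourier_coe_eq_expTwoPi (k : ℤ) (x : ℝ) :
    fourier k (x : UnitAddCircle) = expTwoPi (k * x) := by
  rw [fourier_coe_apply, expTwoPi]
  congr 1
  push_cast
  simp
  ring

/-- The uniform probability measure on the first `N + 1` points of a sequence in the circle. -/
noncomputable def empiricalMeasure (x : ℕ → UnitAddCircle) (N : ℕ) : Measure UnitAddCircle :=
  ((N : ENNReal) + 1)⁻¹ • ∑ n ∈ Icc 1 (N + 1), Measure.dirac (x n)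

instance (x : ℕ → UnitAddCircle) (N : ℕ) : IsProbabilityMeasure (empiricalMeasure x N) := by
  refine ⟨?_⟩
  simp [empiricalMeasure]
  exact ENNReal.inv_mul_cancel (by simp) (by finiteness)

theorem integral_empiricalMeasure (x : ℕ → UnitAddCircle) (N : ℕ) (g : C(UnitAddCircle, ℂ)) :
    ∫ t, g t ∂empiricalMeasure x N =
      ((N + 1 : ℕ) : ℂ)⁻¹ * ∑ n ∈ Icc 1 (N + 1), g (x n) := by
  rw [empiricalMeasure, integral_smul_measure, integral_finsetSum_measure fun i _ =>
    integrable_dirac (by simp)]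
  simp [ENNReal.toReal_add]

theorem norm_integral_sub_le_of_isProbabilityMeasure {μ : Measure UnitAddCircle}
    [IsProbabilityMeasure μ] (f g : C(UnitAddCircle, ℂ)) :
    ‖∫ t, f t ∂μ - ∫ t, g t ∂μ‖ ≤ dist f g := by
  rw [← integral_sub (f.continuous.integrable_of_hasCompactSupport
      (HasCompactSupport.of_compactSpace _)) (g.continuous.integrable_of_hasCompactSupport
      (HasCompactSupport.of_compactSpace _))]
  refine (norm_integral_le_of_norm_le_const (C := dist f g) (ae_of_all _ fun t => ?_)).trans_eq
    (by simp)
  rw [← dist_eq_norm]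
  exact ContinuousMap.dist_apply_le_dist t

instance : IsProbabilityMeasure (volume : Measure UnitAddCircle) := ⟨UnitAddCircle.measure_univ⟩

theorem tendsto_integral_empiricalMeasure {x : ℕ → UnitAddCircle}
    (h : ∀ k : ℤ, k ≠ 0 → Tendsto (fun N : ℕ => (N : ℂ)⁻¹ * ∑ n ∈ Icc 1 N, fourier k (x n))
      atTop (𝓝 0)) (g : C(UnitAddCircle, ℂ)) :
    Tendsto (fun N => ∫ t, g t ∂empiricalMeasure x N) atTop (𝓝 (∫ t, g t)) := by
  have hInt : ∀ (f : C(UnitAddCircle, ℂ)) (μ : Measure UnitAddCircle) [IsProbabilityMeasure μ],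
      Integrable (fun t => f t) μ := fun f μ _ =>
    f.continuous.integrable_of_hasCompactSupport (HasCompactSupport.of_compactSpace _)
  have hspan : ∀ f ∈ Submodule.span ℂ (Set.range (@fourier 1)),
      Tendsto (fun N => ∫ t, f t ∂empiricalMeasure x N) atTop (𝓝 (∫ t, f t)) := by
    intro f hf
    induction hf using Submodule.span_induction with
    | mem f hf =>
      obtain ⟨k, rfl⟩ := hf
      by_cases hk : k = 0
      · subst hk; simp
      · rw [integral_fourier_unitAddCircle hk]
        simp only [integral_empiricalMeasure]
        exact (h k hk).comp (tendsto_add_atTop_nat 1)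
    | zero => simp
    | add f g _ _ hf hg =>
      simp only [ContinuousMap.add_apply, integral_add (hInt f _) (hInt g _)]
      exact hf.add hg
    | smul a f _ hf =>
      simp only [ContinuousMap.smul_apply, integral_smul]
      exact hf.const_smul a
  rw [Metric.tendsto_nhds]
  intro ε hε
  have hg : g ∈ closure (Submodule.span ℂ (Set.range (@fourier 1)) : Set C(UnitAddCircle, ℂ)) := by
    rw [← Submodule.topologicalClosure_coe, span_fourier_closure_eq_top]
    trivial
  obtain ⟨f, hf, hfg⟩ := Metric.mem_closure_iff.1 hg (ε / 3) (by positivity)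
  filter_upwards [Metric.tendsto_nhds.1 (hspan f hf) (ε / 3) (by positivity)] with N hN
  have h1 := norm_integral_sub_le_of_isProbabilityMeasure (μ := empiricalMeasure x N) g f
  have h2 := norm_integral_sub_le_of_isProbabilityMeasure (μ := volume) f g
  rw [dist_comm f g, ← dist_eq_norm] at h2
  rw [← dist_eq_norm] at h1
  linarith [dist_triangle4 (∫ t, g t ∂empiricalMeasure x N) (∫ t, f t ∂empiricalMeasure x N)
    (∫ t, f t) (∫ t, g t)]

/-- The half-open arc `[a, b)` of the circle, for `0 ≤ a` and `b ≤ 1`. -/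
def arc (a b : ℝ) : Set UnitAddCircle := {t | (AddCircle.equivIco 1 0 t : ℝ) ∈ Set.Ico a b}

theorem coe_mem_arc {a b x : ℝ} :
    (x : UnitAddCircle) ∈ arc a b ↔ a ≤ Int.fract x ∧ Int.fract x < b := by
  have : (AddCircle.equivIco 1 0 (x : UnitAddCircle) : ℝ) = Int.fract x := by
    have := AddCircle.coe_equivIco_mk_apply (p := (1 : ℝ)) x
    rwa [div_one, mul_one] at this
  rw [arc, Set.mem_ofPred_eq, this]; rfl

theorem arc_eq_image {a b : ℝ} (ha : 0 ≤ a) (hb : b ≤ 1) :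
    arc a b = ((↑) : ℝ → UnitAddCircle) '' Set.Ico a b := by
  ext t
  constructor
  · intro ht
    exact ⟨_, ht, (AddCircle.equivIco 1 0).symm_apply_apply t⟩
  · rintro ⟨x, hx, rfl⟩
    rw [coe_mem_arc, Int.fract_eq_self.2 ⟨ha.trans hx.1, hx.2.trans_le hb⟩]
    exact hx

theorem measurableSet_arc (a b : ℝ) : MeasurableSet (arc a b) :=
  measurableSet_Ico.preimage
    (measurable_subtype_coe.comp (AddCircle.measurableEquivIco 1 0).measurable)

theorem volume_arc {a b : ℝ} (ha : 0 ≤ a) (hb : b ≤ 1) :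
    volume (arc a b) = ENNReal.ofReal (b - a) := by
  rw [← (UnitAddCircle.measurePreserving_mk 0).measure_preimage (measurableSet_arc a b).nullMeasurableSet,
    Measure.restrict_congr_set (Ioo_ae_eq_Ioc (a := (0 : ℝ)) (b := 0 + 1)).symm,
    Measure.restrict_congr_set Ioo_ae_eq_Ico,
    Measure.restrict_apply' measurableSet_Ico, ← Real.volume_Ico]
  congr 1
  ext y
  simp only [Set.mem_inter_iff, Set.mem_preimage, coe_mem_arc, Set.mem_Ico, zero_add]
  constructor
  · rintro ⟨h, hy⟩
    rwa [Int.fract_eq_self.2 hy] at h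
  · intro h
    have hy : 0 ≤ y ∧ y < 1 := ⟨ha.trans h.1, h.2.trans_le hb⟩
    rw [Int.fract_eq_self.2 hy]
    exact ⟨h, hy⟩

theorem volume_frontier_arc {a b : ℝ} (ha : 0 ≤ a) (hb : b ≤ 1) :
    volume (frontier (arc a b)) = 0 := by
  have hsub : frontier (arc a b) ⊆ ((↑) : ℝ → UnitAddCircle) '' {a, b} := by
    rw [arc_eq_image ha hb]
    rintro t ⟨ht1, ht2⟩
    have hc : closure (((↑) : ℝ → UnitAddCircle) '' Set.Ico a b) ⊆
        ((↑) : ℝ → UnitAddCircle) '' Set.Icc a b :=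
      closure_minimal (Set.image_mono Set.Ico_subset_Icc_self)
        (isCompact_Icc.image (AddCircle.continuous_mk' 1)).isClosed
    have ho : ((↑) : ℝ → UnitAddCircle) '' Set.Ioo a b ⊆
        interior (((↑) : ℝ → UnitAddCircle) '' Set.Ico a b) :=
      interior_maximal (Set.image_mono Set.Ioo_subset_Ico_self)
        (QuotientAddGroup.isOpenMap_coe _ isOpen_Ioo)
    obtain ⟨y, hy, rfl⟩ := hc ht1
    refine ⟨y, ?_, rfl⟩
    by_contra hne
    simp only [Set.mem_insert_iff, Set.mem_singleton_iff, not_or] at hne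
    exact ht2 (ho ⟨y, ⟨lt_of_le_of_ne hy.1 (Ne.symm hne.1), lt_of_le_of_ne hy.2 hne.2⟩, rfl⟩)
  refine measure_mono_null hsub ?_
  have hpt : ∀ t : UnitAddCircle, volume {t} = 0 := fun t => by
    rw [← Metric.closedBall_zero, AddCircle.volume_closedBall]
    simp
  rw [Set.image_pair]
  exact measure_union_null (hpt _) (hpt _)

/-- **Weyl's criterion**, sufficiency. -/
theorem udMod1_of_tendsto_expTwoPi {x : ℕ → ℝ}
    (h : ∀ k : ℤ, k ≠ 0 → Tendsto (fun N : ℕ => (N : ℂ)⁻¹ * ∑ n ∈ Icc 1 N, expTwoPi (k * x n))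
      atTop (𝓝 0)) : udMod1 x := by
  intro a b ha hab hb
  set y : ℕ → UnitAddCircle := fun n => (x n : UnitAddCircle) with hy
  obtain ⟨μ, hμ⟩ : ∃ μ : ℕ → ProbabilityMeasure UnitAddCircle,
      ∀ N, (μ N : Measure UnitAddCircle) = empiricalMeasure y N :=
    ⟨fun N => ⟨empiricalMeasure y N, inferInstance⟩, fun _ => rfl⟩
  obtain ⟨ν, hν⟩ : ∃ ν : ProbabilityMeasure UnitAddCircle, (ν : Measure UnitAddCircle) = volume :=
    ⟨⟨volume, inferInstance⟩, rfl⟩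
  have hw : Tendsto μ atTop (𝓝 ν) := by
    rw [ProbabilityMeasure.tendsto_iff_forall_integral_rclike_tendsto ℂ]
    intro g
    simp only [hμ, hν]
    refine tendsto_integral_empiricalMeasure (fun k hk => ?_) g.toContinuousMap
    simpa only [hy, fourier_coe_eq_expTwoPi] using h k hk
  have hm := ProbabilityMeasure.tendsto_measure_of_null_frontier_of_tendsto' hw
    (E := arc a b) (by rw [hν]; exact volume_frontier_arc ha hb)
  have hr := (ENNReal.tendsto_toReal (measure_ne_top _ _)).comp hm
  simp only [Function.comp_def, hμ, hν, volume_arc ha hb,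
    ENNReal.toReal_ofReal (sub_nonneg.2 hab.le)] at hr
  rw [← tendsto_add_atTop_iff_nat 1]
  convert hr using 2 with N
  rw [empiricalMeasure, Measure.smul_apply, Measure.finsetSum_apply]
  have hind : ∀ n, (arc a b).indicator 1 (x n : UnitAddCircle) =
      if a ≤ Int.fract (x n) ∧ Int.fract (x n) < b then (1 : ENNReal) else 0 := fun n => by
    classical
    simp only [Set.indicator_apply, coe_mem_arc, Pi.one_apply]
  simp only [Measure.dirac_apply' _ (measurableSet_arc a b), hy, hind, sum_boole, smul_eq_mul,
    ENNReal.toReal_mul, ENNReal.toReal_inv, ENNReal.toReal_natCast]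
  rw [ENNReal.toReal_add (by simp) (by simp)]
  simp
  ring

theorem sum_expTwoPi_div_eq_zero {K : ℕ} (hK : 1 < K) :
    ∑ i ∈ range K, expTwoPi ((i : ℝ) / K) = 0 := by
  rw [← (Complex.isPrimitiveRoot_exp K (by omega)).geom_sum_eq_zero hK]
  refine sum_congr rfl fun i _ => ?_
  rw [← Complex.exp_nat_mul, expTwoPi]
  congr 1
  push_cast
  ring

theorem expTwoPi_fract (x : ℝ) : expTwoPi (Int.fract x) = expTwoPi x := by
  rw [Int.fract, expTwoPi, expTwoPi, Complex.exp_eq_exp_iff_exists_int]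
  exact ⟨-⌊x⌋, by push_cast; ring⟩

/-- **Weyl's criterion**, necessity for the first exponential sum. -/
theorem tendsto_expTwoPi_of_udMod1 {x : ℕ → ℝ} (h : udMod1 x) :
    Tendsto (fun N : ℕ => (N : ℂ)⁻¹ * ∑ n ∈ Icc 1 N, expTwoPi (x n)) atTop (𝓝 0) := by
  rw [Metric.tendsto_nhds]
  intro ε hε
  obtain ⟨K, hK⟩ := exists_nat_gt (max 1 (2 * Real.pi / (ε / 2)))
  have hK1 : (1 : ℝ) < K := (le_max_left _ _).trans_lt hK
  have hK0 : (0 : ℝ) < K := by linarith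
  have hK2 : 2 * Real.pi / K < ε / 2 := by
    rw [div_lt_comm₀ hK0 (by positivity)]
    exact (le_max_right _ _).trans_lt hK
  have hfl : ∀ n, ⌊K * Int.fract (x n)⌋₊ < K := fun n => by
    rw [Nat.floor_lt (by have := Int.fract_nonneg (x n); positivity)]
    exact mul_lt_of_lt_one_right hK0 (Int.fract_lt_one _)
  have hcount : ∀ (N i : ℕ), ((Icc 1 N).filter fun n => ⌊K * Int.fract (x n)⌋₊ = i) =
      (Icc 1 N).filter fun n =>
        (i : ℝ) / K ≤ Int.fract (x n) ∧ Int.fract (x n) < ((i : ℝ) + 1) / K := by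
    refine fun N i => filter_congr fun n _ => ?_
    rw [Nat.floor_eq_iff (by have := Int.fract_nonneg (x n); positivity), div_le_iff₀ hK0,
      lt_div_iff₀ hK0, mul_comm]
  have hstep : Tendsto (fun N : ℕ => (N : ℂ)⁻¹ *
      ∑ n ∈ Icc 1 N, expTwoPi ((⌊K * Int.fract (x n)⌋₊ : ℝ) / K)) atTop (𝓝 0) := by
    have hlim : Tendsto (fun N : ℕ => ∑ i ∈ range K,
        (((((Icc 1 N).filter fun n => ⌊K * Int.fract (x n)⌋₊ = i).card : ℝ) / N : ℝ) : ℂ) *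
          expTwoPi ((i : ℝ) / K)) atTop
        (𝓝 (∑ i ∈ range K, (((1 : ℝ) / K : ℝ) : ℂ) * expTwoPi ((i : ℝ) / K))) := by
      refine tendsto_finsetSum _ fun i hi => Tendsto.mul_const _ ?_
      refine (Complex.continuous_ofReal.tendsto _).comp ?_
      simp only [hcount]
      have hiK : (i : ℝ) + 1 ≤ K := by exact_mod_cast mem_range.1 hi
      convert h (i / K) ((i + 1) / K) (by positivity) (by gcongr; linarith)
        ((div_le_one hK0).2 hiK) using 2
      ring
    rw [← mul_sum, sum_expTwoPi_div_eq_zero (by exact_mod_cast hK1), mul_zero] at hlim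
    refine hlim.congr fun N => ?_
    rw [← sum_fiberwise_of_maps_to (s := Icc 1 N) (t := range K)
      (g := fun n => ⌊K * Int.fract (x n)⌋₊) fun n _ => mem_range.2 (hfl n), mul_sum]
    refine sum_congr rfl fun i _ => ?_
    rw [sum_congr rfl fun n hn => by rw [(mem_filter.1 hn).2]]
    rw [sum_const, nsmul_eq_mul]
    push_cast
    ring
  filter_upwards [Metric.tendsto_nhds.1 hstep (ε / 2) (by positivity), eventually_gt_atTop 0]
    with N hN hN0
  rw [dist_zero_right] at hN ⊢
  have hN0' : (0 : ℝ) < N := by exact_mod_cast hN0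
  have hdiff : ‖(N : ℂ)⁻¹ * ∑ n ∈ Icc 1 N, expTwoPi (x n) - (N : ℂ)⁻¹ *
      ∑ n ∈ Icc 1 N, expTwoPi ((⌊K * Int.fract (x n)⌋₊ : ℝ) / K)‖ ≤ 2 * Real.pi / K := by
    rw [← mul_sub, ← sum_sub_distrib, norm_mul, norm_inv, Complex.norm_natCast,
      inv_mul_le_iff₀ hN0']
    refine (norm_sum_le_of_le (n := fun _ => 2 * Real.pi / K) _ fun n _ => ?_).trans_eq (by simp)
    rw [← expTwoPi_fract (x n)]
    refine (norm_expTwoPi_sub_le _ _).trans ?_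
    have h1 := Nat.floor_le (a := K * Int.fract (x n))
      (by have := Int.fract_nonneg (x n); positivity)
    have h2 := Nat.lt_floor_add_one (K * Int.fract (x n))
    have h3 : |Int.fract (x n) - (⌊K * Int.fract (x n)⌋₊ : ℝ) / K| ≤ 1 / K := by
      rw [abs_le]
      constructor
      · rw [neg_le, neg_sub, sub_le_iff_le_add]
        have : (⌊K * Int.fract (x n)⌋₊ : ℝ) / K ≤ Int.fract (x n) := by
          rw [div_le_iff₀ hK0]; linarith
        have : (0 : ℝ) ≤ 1 / K := by positivity
        linarith
      · rw [sub_le_iff_le_add, ← add_div, le_div_iff₀ hK0]; linarith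
    have := Real.pi_pos
    calc 2 * Real.pi * _ ≤ 2 * Real.pi * (1 / K) := by gcongr
      _ = _ := by ring
  have := norm_le_norm_add_norm_sub' ((N : ℂ)⁻¹ * ∑ n ∈ Icc 1 N, expTwoPi (x n))
    ((N : ℂ)⁻¹ * ∑ n ∈ Icc 1 N, expTwoPi ((⌊K * Int.fract (x n)⌋₊ : ℝ) / K))
  linarith

end WeylCriterion

section PowersOfOmega

open Topology

theorem tendsto_average_sub_logAvg_self {f : ℕ → ℂ} (hf : ∀ k, ‖f k‖ ≤ 1) :
    Tendsto (fun N : ℕ => (N : ℂ)⁻¹ * ∑ n ∈ Icc 1 N, f (bigOmega n) -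
      logAvg N (fun n => f (bigOmega n))) atTop (𝓝 0) := by
  have h2 : Tendsto (fun N : ℕ => logAvg N (fun n => f (bigOmega n)) -
      logAvg N (fun n => f (bigOmega n + 1))) atTop (𝓝 0) := by
    refine squeeze_zero_norm' ?_ ((Real.tendsto_sqrt_atTop.comp tendsto_primeSum).const_div_atTop 21)
    filter_upwards [tendsto_primeSum.eventually_ge_atTop 1, eventually_ge_atTop 1] with N hl hN
    simpa using norm_logAvg_sub_shift_le hN hl hf 1
  have := (tendsto_average_sub_logAvg hf).sub h2
  simpa using this

theorem norm_logAvg_sub_logAvg_smooth_le {N : ℕ} (hN : 1 ≤ N) (hl : 1 ≤ primeSum N) {g : ℕ → ℂ}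
    (hg : ∀ k, ‖g k‖ ≤ 1) {J : ℕ} (hJ : 1 ≤ J) :
    ‖logAvg N (fun n => g (bigOmega n)) -
      logAvg N (fun n => (J : ℂ)⁻¹ * ∑ j ∈ range J, g (bigOmega n + j))‖ ≤
      J * (21 / √(primeSum N)) := by
  have hJ0 : (0 : ℝ) < J := by exact_mod_cast hJ
  have hJ1 : (J : ℂ) ≠ 0 := by exact_mod_cast hJ0.ne'
  have h : logAvg N (fun n => g (bigOmega n)) -
      logAvg N (fun n => (J : ℂ)⁻¹ * ∑ j ∈ range J, g (bigOmega n + j)) =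
      (J : ℂ)⁻¹ * ∑ j ∈ range J,
        (logAvg N (fun n => g (bigOmega n)) - logAvg N (fun n => g (bigOmega n + j))) := by
    rw [logAvg_const_mul, logAvg_sum, sum_sub_distrib, mul_sub]
    simp [hJ1]
  rw [h, norm_mul, norm_inv, Complex.norm_natCast, inv_mul_le_iff₀ hJ0]
  refine (norm_sum_le_of_le (n := fun _ => J * (21 / √(primeSum N))) _ fun j hj => ?_).trans_eq
    (by simp)
  refine (norm_logAvg_sub_shift_le hN hl hg j).trans ?_
  have : (j : ℝ) ≤ J := by exact_mod_cast (mem_range.1 hj).le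
  rw [mul_one]
  gcongr

theorem tendsto_logAvg_expTwoPi_rpow {c h : ℝ} (hc : 1 / 2 < c) (hc' : ¬∃ m : ℤ, c = (m : ℝ))
    (hh : h ≠ 0) :
    Tendsto (fun N => logAvg N (fun n => expTwoPi (h * (bigOmega n : ℝ) ^ c))) atTop (𝓝 0) := by
  rw [Metric.tendsto_nhds]
  intro η hη
  set ε := η / 24 with hε
  have hε0 : 0 < ε := by positivity
  obtain ⟨δ, hδ, hδε, hW⟩ := exists_eventually_norm_sum_expTwoPi_rpow_le hc hc' hh hε0
  have hsq := Real.tendsto_sqrt_atTop.comp tendsto_primeSum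
  filter_upwards [tendsto_primeSum.eventually hW, tendsto_primeSum.eventually_ge_atTop 1,
    eventually_ge_atTop 1, (hsq.const_mul_atTop hδ).eventually_ge_atTop 1,
    hsq.eventually_gt_atTop (22 / ε)] with N hW hl hN hJ1 hs
  simp only [Function.comp_apply] at hJ1 hs
  set l := primeSum N with hldef
  have hl0 : 0 < l := by linarith
  have hss : √l * √l = l := Real.mul_self_sqrt hl0.le
  have hs0 : 0 < √l := Real.sqrt_pos.2 hl0
  set J := ⌊δ * √l⌋₊ with hJ
  have hJ1' : 1 ≤ J := Nat.le_floor (by simpa using hJ1)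
  have hJ0 : (0 : ℝ) < J := by exact_mod_cast hJ1'
  have hJle : (J : ℝ) ≤ δ * √l := Nat.floor_le (by positivity)
  set g : ℕ → ℂ := fun k => expTwoPi (h * (k : ℝ) ^ c) with hg
  have hg1 : ∀ k, ‖g k‖ ≤ 1 := fun k => (norm_expTwoPi _).le
  have h1 := norm_logAvg_sub_logAvg_smooth_le hN hl hg1 hJ1'
  rw [← hldef] at h1
  have h2 : ‖logAvg N (fun n => (J : ℂ)⁻¹ * ∑ j ∈ range J, g (bigOmega n + j))‖ ≤
      ε + 2 / l * (11 * √l) := by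
    have hpt : ∀ k : ℕ, ‖(J : ℂ)⁻¹ * ∑ j ∈ range J, g (k + j)‖ ≤ ε + 2 / l * |(k : ℝ) - l| := by
      intro k
      rw [norm_mul, norm_inv, Complex.norm_natCast, inv_mul_le_iff₀ hJ0]
      by_cases hk : l / 2 ≤ k ∧ (k : ℝ) ≤ 2 * l
      · have := hW k hk.1 hk.2
        simp only [hg, Nat.cast_add]
        refine this.trans ?_
        rw [mul_comm]
        gcongr
        have : 0 ≤ 2 / l * |(k : ℝ) - l| := by positivity
        linarith
      · have hbig : l / 2 ≤ |(k : ℝ) - l| := by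
          rw [le_abs]
          by_contra hcon
          push Not at hcon
          exact hk ⟨by linarith, by linarith⟩
        have : 1 ≤ 2 / l * |(k : ℝ) - l| := by
          calc (1 : ℝ) = 2 / l * (l / 2) := by field_simp
            _ ≤ _ := by gcongr
        calc ‖∑ j ∈ range J, g (k + j)‖ ≤ ∑ j ∈ range J, (1 : ℝ) :=
              norm_sum_le_of_le _ fun j _ => hg1 _
          _ = J * 1 := by simp
          _ ≤ _ := by gcongr; linarith
    refine (norm_logAvg_le_of_le fun n _ => hpt (bigOmega n)).trans ?_
    rw [logAvg_add, logAvg_const hN, logAvg_const_mul]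
    gcongr
    exact logAvg_abs_bigOmega_sub_le hN hl
  have h3 : 2 / l * (11 * √l) < ε := by
    have : 2 / l * (11 * √l) = 22 / √l := by
      nth_rewrite 1 [← hss]
      field_simp
      norm_num
    rw [this]
    exact (div_lt_comm₀ hε0 hs0).1 hs
  have h4 : J * (21 / √l) ≤ 21 * ε := by
    calc J * (21 / √l) ≤ (δ * √l) * (21 / √l) := by gcongr
      _ = 21 * δ := by field_simp
      _ ≤ 21 * ε := by gcongr
  rw [dist_zero_right]
  have h5 := norm_le_norm_add_norm_sub' (logAvg N (fun n => g (bigOmega n)))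
    (logAvg N (fun n => (J : ℂ)⁻¹ * ∑ j ∈ range J, g (bigOmega n + j)))
  linarith

theorem abs_rpow_sub_rpow_le {x y c : ℝ} (hx : 0 ≤ x) (hy : 0 < y) (hc : 0 ≤ c) (hc1 : c ≤ 1) :
    |x ^ c - y ^ c| ≤ y ^ (c - 1) * |x - y| := by
  have h1 : |(x / y) ^ c - 1| ≤ |x / y - 1| := by
    have ht : 0 ≤ x / y := by positivity
    rcases le_total 1 (x / y) with h | h
    · rw [abs_of_nonneg (by linarith [Real.one_le_rpow h hc]), abs_of_nonneg (by linarith)]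
      linarith [Real.rpow_le_self_of_one_le h hc1]
    · rw [abs_of_nonpos (by linarith [Real.rpow_le_one ht h hc]), abs_of_nonpos (by linarith)]
      linarith [Real.self_le_rpow_of_le_one ht h hc1]
  have h2 : x ^ c - y ^ c = y ^ c * ((x / y) ^ c - 1) := by
    rw [Real.div_rpow hx hy.le]
    have := (Real.rpow_pos_of_pos hy c).ne'
    field_simp
  have h3 : y ^ (c - 1) * |x - y| = y ^ c * |x / y - 1| := by
    rw [Real.rpow_sub hy, Real.rpow_one, div_sub_one hy.ne', abs_div, abs_of_pos hy]
    ring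
  rw [h2, h3, abs_mul, abs_of_pos (Real.rpow_pos_of_pos hy c)]
  gcongr

theorem not_tendsto_logAvg_expTwoPi_rpow_of_lt {c : ℝ} (hc0 : 0 < c) (hc : c < 1 / 2) :
    ¬Tendsto (fun N => logAvg N (fun n => expTwoPi ((bigOmega n : ℝ) ^ c))) atTop (𝓝 0) := by
  intro h
  have hlim : Tendsto (fun N => 2 * Real.pi * (11 * primeSum N ^ (-(1 / 2 - c)))) atTop (𝓝 0) := by
    have := ((tendsto_rpow_neg_atTop (by linarith : 0 < 1 / 2 - c)).comp
      tendsto_primeSum).const_mul 11 |>.const_mul (2 * Real.pi)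
    simpa using this
  obtain ⟨N, h1, h2, hl, hN⟩ := ((Metric.tendsto_nhds.1 h (1 / 2) (by norm_num)).and
    ((hlim.eventually_lt_const (by norm_num : (0 : ℝ) < 1 / 2)).and
      ((tendsto_primeSum.eventually_ge_atTop 1).and (eventually_ge_atTop 1)))).exists
  set l := primeSum N with hldef
  have hl0 : 0 < l := by linarith
  rw [dist_zero_right] at h1
  have h3 : ‖logAvg N (fun n => expTwoPi ((bigOmega n : ℝ) ^ c) - expTwoPi (l ^ c))‖ ≤
      2 * Real.pi * (11 * l ^ (-(1 / 2 - c))) := by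
    have hpt : ∀ n ∈ Icc 1 N, ‖expTwoPi ((bigOmega n : ℝ) ^ c) - expTwoPi (l ^ c)‖ ≤
        2 * Real.pi * l ^ (c - 1) * |(bigOmega n : ℝ) - l| := fun n _ => by
      refine (norm_expTwoPi_sub_le _ _).trans ?_
      calc _ ≤ 2 * Real.pi * (l ^ (c - 1) * |(bigOmega n : ℝ) - l|) :=
            mul_le_mul_of_nonneg_left
              (abs_rpow_sub_rpow_le (Nat.cast_nonneg _) hl0 hc0.le (by linarith)) (by positivity)
        _ = _ := by ring
    refine (norm_logAvg_le_of_le hpt).trans ?_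
    rw [logAvg_const_mul]
    have hpi := Real.pi_pos
    calc 2 * Real.pi * l ^ (c - 1) * _ ≤ 2 * Real.pi * l ^ (c - 1) * (11 * √l) := by
          gcongr; exact logAvg_abs_bigOmega_sub_le hN hl
      _ = 2 * Real.pi * (11 * (l ^ (c - 1) * l ^ (1 / 2 : ℝ))) := by
          rw [Real.sqrt_eq_rpow]; ring
      _ = _ := by rw [← Real.rpow_add hl0]; congr 3; ring
  rw [logAvg_sub, logAvg_const hN, norm_sub_rev] at h3
  have h4 := norm_le_norm_add_norm_sub' (expTwoPi (l ^ c))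
    (logAvg N (fun n => expTwoPi ((bigOmega n : ℝ) ^ c)))
  rw [norm_expTwoPi] at h4
  linarith

/-- The characteristic function of `Ω` in logarithmic mean stays away from `0` on the scale of the
standard deviation. -/
theorem le_norm_logAvg_exp_bigOmega {N : ℕ} (hN : 1 ≤ N) {t : ℝ} (ht : 0 ≤ t) :
    (1 - 10 * Real.exp (primeSum N * t ^ 2 / 2) * t) * Real.exp (-(primeSum N * t ^ 2 / 2)) ≤
      ‖logAvg N (fun n => Complex.exp (Complex.I * t * bigOmega n))‖ := by
  set l := primeSum N with hldef
  have hl0 : 0 ≤ l := primeSum_nonneg N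
  set u : ℝ → ℂ := fun s => Complex.exp (Complex.I * s) with hu
  have hupow : ∀ (s : ℝ) (k : ℕ), Complex.exp (Complex.I * s * k) = u s ^ k := fun s k => by
    rw [hu, ← Complex.exp_nat_mul, mul_comm]
  have hunorm : ∀ s, ‖u s‖ = 1 := fun s => by
    simp only [hu]; rw [mul_comm]; exact Complex.norm_exp_ofReal_mul_I s
  set ψ : ℝ → ℂ := fun s => logAvg N (fun n => u s ^ bigOmega n) with hψ
  set w : ℝ → ℂ := fun s => Complex.exp (-(l * (u s - 1))) with hw
  have hwnorm : ∀ s, ‖w s‖ ≤ Real.exp (l * s ^ 2 / 2) := fun s => by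
    rw [hw, Complex.norm_exp, Real.exp_le_exp]
    have : (-((l : ℂ) * (u s - 1))).re = l * (1 - Real.cos s) := by
      simp only [hu]
      rw [mul_comm Complex.I, Complex.exp_mul_I, ← Complex.ofReal_cos, ← Complex.ofReal_sin]
      simp [-Complex.ofReal_cos, -Complex.ofReal_sin]
      ring
    rw [this]
    nlinarith [Real.one_sub_sq_div_two_le_cos (x := s)]
  have hu' : ∀ s, HasDerivAt u (Complex.I * u s) s := fun s => by
    have h1 : HasDerivAt (fun s : ℝ => Complex.I * (s : ℂ)) Complex.I s := by
      simpa using (Complex.ofRealCLM.hasDerivAt (x := s)).const_mul Complex.I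
    simpa [hu, mul_comm] using h1.cexp
  set ψ' : ℝ → ℂ := fun s => Complex.I * logAvg N (fun n => (bigOmega n : ℝ) • u s ^ bigOmega n)
    with hψ'
  have hψd : ∀ s, HasDerivAt ψ (ψ' s) s := fun s => by
    have : ∀ n ∈ Icc 1 N, HasDerivAt (fun s => (n : ℝ)⁻¹ • u s ^ bigOmega n)
        ((n : ℝ)⁻¹ • (Complex.I * ((bigOmega n : ℝ) • u s ^ bigOmega n))) s := fun n _ => by
      refine HasDerivAt.fun_const_smul _ (((hu' s).fun_pow (bigOmega n)).congr_deriv ?_)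
      rcases Nat.eq_zero_or_pos (bigOmega n) with h0 | h0
      · simp [h0]
      · obtain ⟨m, hm⟩ := Nat.exists_eq_succ_of_ne_zero h0.ne'
        simp [hm, pow_succ]
        ring
    have h2 := (HasDerivAt.fun_sum this).fun_const_smul (harmonicSum N)⁻¹
    simp only [hψ']
    rw [← logAvg_const_mul]
    exact h2
  have hwd : ∀ s, HasDerivAt w (w s * -(l * (Complex.I * u s))) s := fun s => by
    exact (((hu' s).sub_const 1).const_mul (l : ℂ)).neg.cexp
  have hstein : ∀ s, ‖ψ' s - l * (Complex.I * u s) * ψ s‖ ≤ 10 := fun s => by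
    have h1 := norm_logAvg_bigOmega_smul_sub_le hN (g := fun k => u s ^ k) (B := 1) fun k => by
      simp [hunorm]
    have h2 : logAvg N (fun n => u s ^ (bigOmega n + 1)) = u s * ψ s := by
      rw [hψ, ← logAvg_const_mul]
      exact logAvg_congr fun n _ => pow_succ' _ _
    simp only [h2, mul_one] at h1
    rw [hψ']
    calc _ = ‖Complex.I * (logAvg N (fun n => (bigOmega n : ℝ) • u s ^ bigOmega n) -
          primeSum N • (u s * ψ s))‖ := by
          congr 1
          rw [Complex.real_smul]
          ring
      _ ≤ 10 := by rw [norm_mul, Complex.norm_I, one_mul]; exact h1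
  have hmv := norm_image_sub_le_of_norm_deriv_le_segment' (f := fun s => w s * ψ s)
    (f' := fun s => w s * (ψ' s - l * (Complex.I * u s) * ψ s)) (a := 0) (b := t)
    (C := 10 * Real.exp (l * t ^ 2 / 2)) (fun s _ => by
      convert ((hwd s).fun_mul (hψd s)).hasDerivWithinAt using 1
      ring) (fun s hs => by
      rw [norm_mul, mul_comm]
      have h1 : Real.exp (l * s ^ 2 / 2) ≤ Real.exp (l * t ^ 2 / 2) := by
        have := hs.1
        have := hs.2.le
        gcongr
      gcongr
      · exact hstein s
      · exact (hwnorm s).trans h1) t ⟨ht, le_rfl⟩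
  have h0 : w 0 * ψ 0 = 1 := by
    simp [hw, hψ, hu, logAvg_const hN]
  rw [h0, sub_zero] at hmv
  have h1 : 1 - 10 * Real.exp (l * t ^ 2 / 2) * t ≤ ‖w t‖ * ‖ψ t‖ := by
    rw [← norm_mul]
    have := norm_le_norm_add_norm_sub' (1 : ℂ) (w t * ψ t)
    rw [norm_sub_rev, norm_one] at this
    linarith
  have h2 : ‖w t‖ * ‖ψ t‖ ≤ Real.exp (l * t ^ 2 / 2) * ‖ψ t‖ := by gcongr; exact hwnorm t
  simp only [hupow]
  rw [Real.exp_neg, ← div_eq_mul_inv, div_le_iff₀ (Real.exp_pos _)]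
  linarith

theorem norm_expTwoPi_sqrt_sub_le {x l : ℝ} (hx : 0 ≤ x) (hl : 0 < l) :
    ‖expTwoPi √x - expTwoPi ((x + l) / (2 * √l))‖ ≤ 4 * (|x - l| / l ^ (3 / 4 : ℝ)) := by
  have hs0 : 0 < √l := Real.sqrt_pos.2 hl
  have hss : √l * √l = l := Real.mul_self_sqrt hl.le
  have hxx : √x * √x = x := Real.mul_self_sqrt hx
  have hx0 : 0 ≤ √x := Real.sqrt_nonneg x
  set y := |x - l| / l ^ (3 / 4 : ℝ) with hy
  have hy0 : 0 ≤ y := by positivity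
  have hysq : y ^ 2 = |x - l| ^ 2 / (l * √l) := by
    have : (l ^ (3 / 4 : ℝ)) ^ 2 = l * √l := by
      rw [← Real.rpow_mul_natCast hl.le, Real.sqrt_eq_rpow, ← Real.rpow_one_add' hl.le (by norm_num)]
      norm_num
    rw [hy, div_pow, this]
  have hsub : |√x - (x + l) / (2 * √l)| ≤ y ^ 2 / 2 := by
    have e1 : √x - (x + l) / (2 * √l) = -((√x - √l) ^ 2 / (2 * √l)) := by
      field_simp
      nlinarith
    rw [e1, abs_neg, abs_of_nonneg (by positivity), hysq]
    have e2 : (√x - √l) ^ 2 * l ≤ |x - l| ^ 2 := by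
      have : |x - l| ^ 2 = (√x - √l) ^ 2 * (√x + √l) ^ 2 := by
        rw [sq_abs, ← mul_pow]
        congr 1
        nlinarith
      rw [this]
      gcongr
      nlinarith
    rw [div_le_div_iff₀ (by positivity) two_pos, div_mul_eq_mul_div, le_div_iff₀ (by positivity)]
    nlinarith
  rcases le_total y 1 with h | h
  · refine (norm_expTwoPi_sub_le _ _).trans ?_
    have := Real.pi_le_four
    have := Real.pi_pos
    calc 2 * Real.pi * _ ≤ 2 * Real.pi * (y ^ 2 / 2) := by gcongr
      _ = Real.pi * y ^ 2 := by ring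
      _ ≤ 4 * y := by gcongr; nlinarith
  · refine (norm_sub_le _ _).trans ?_
    rw [norm_expTwoPi, norm_expTwoPi]
    linarith

theorem not_tendsto_logAvg_expTwoPi_sqrt :
    ¬Tendsto (fun N => logAvg N (fun n => expTwoPi √(bigOmega n : ℝ))) atTop (𝓝 0) := by
  intro h
  set κ := Real.exp (-(Real.pi ^ 2 / 2)) with hκ
  have hκ0 : 0 < κ := Real.exp_pos _
  have hsq := Real.tendsto_sqrt_atTop.comp tendsto_primeSum
  have hlim1 : Tendsto (fun N => 10 * Real.exp (Real.pi ^ 2 / 2) * (Real.pi / √(primeSum N)))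
      atTop (𝓝 0) := by
    simpa using (hsq.const_div_atTop Real.pi).const_mul (10 * Real.exp (Real.pi ^ 2 / 2))
  have hlim2 : Tendsto (fun N => 44 * primeSum N ^ (-(1 / 4 : ℝ))) atTop (𝓝 0) := by
    simpa using ((tendsto_rpow_neg_atTop (by norm_num : (0 : ℝ) < 1 / 4)).comp
      tendsto_primeSum).const_mul 44
  obtain ⟨N, h1, h2, h3, hl, hN⟩ := ((Metric.tendsto_nhds.1 h (κ / 4) (by positivity)).and
    ((hlim1.eventually_lt_const (by norm_num : (0 : ℝ) < 1 / 2)).and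
      ((hlim2.eventually_lt_const (by positivity : 0 < κ / 4)).and
      ((tendsto_primeSum.eventually_ge_atTop 1).and (eventually_ge_atTop 1))))).exists
  set l := primeSum N with hldef
  have hl0 : 0 < l := by linarith
  have hs0 : 0 < √l := Real.sqrt_pos.2 hl0
  have hss : √l * √l = l := Real.mul_self_sqrt hl0.le
  have hpi := Real.pi_pos
  rw [dist_zero_right] at h1
  have h4 : ‖logAvg N (fun n => expTwoPi √(bigOmega n : ℝ) -
      expTwoPi (((bigOmega n : ℝ) + l) / (2 * √l)))‖ ≤ 44 * l ^ (-(1 / 4 : ℝ)) := by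
    have hpt : ∀ n ∈ Icc 1 N, ‖expTwoPi √(bigOmega n : ℝ) -
        expTwoPi (((bigOmega n : ℝ) + l) / (2 * √l))‖ ≤
        4 / l ^ (3 / 4 : ℝ) * |(bigOmega n : ℝ) - l| := fun n _ =>
      (norm_expTwoPi_sqrt_sub_le (Nat.cast_nonneg _) hl0).trans_eq (by ring)
    refine (norm_logAvg_le_of_le hpt).trans ?_
    rw [logAvg_const_mul]
    calc 4 / l ^ (3 / 4 : ℝ) * _ ≤ 4 / l ^ (3 / 4 : ℝ) * (11 * √l) := by
          gcongr; exact logAvg_abs_bigOmega_sub_le hN hl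
      _ = 44 * (l ^ (1 / 2 : ℝ) / l ^ (3 / 4 : ℝ)) := by rw [Real.sqrt_eq_rpow]; ring
      _ = _ := by rw [← Real.rpow_sub hl0]; norm_num
  rw [logAvg_sub] at h4
  have h5 : logAvg N (fun n => expTwoPi (((bigOmega n : ℝ) + l) / (2 * √l))) =
      expTwoPi (√l / 2) *
        logAvg N (fun n => Complex.exp (Complex.I * (Real.pi / √l : ℝ) * bigOmega n)) := by
    rw [← logAvg_const_mul]
    refine logAvg_congr fun n _ => ?_
    have : ((bigOmega n : ℝ) + l) / (2 * √l) = √l / 2 + (bigOmega n : ℝ) / (2 * √l) := by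
      nth_rewrite 1 [← hss]
      field_simp
      ring
    rw [this, expTwoPi_add]
    congr 1
    rw [expTwoPi]
    congr 1
    push_cast
    field_simp
  have h6 := le_norm_logAvg_exp_bigOmega hN (t := Real.pi / √l) (by positivity)
  have h7 : primeSum N * (Real.pi / √l) ^ 2 / 2 = Real.pi ^ 2 / 2 := by
    rw [← hldef, div_pow, Real.sq_sqrt hl0.le]
    field_simp
  rw [h7, ← hκ] at h6
  have h8 : κ / 2 ≤ ‖logAvg N (fun n => expTwoPi (((bigOmega n : ℝ) + l) / (2 * √l)))‖ := by
    rw [h5, norm_mul, norm_expTwoPi, one_mul]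
    refine le_trans ?_ h6
    nlinarith
  rw [norm_sub_rev] at h4
  have h9 := norm_le_norm_add_norm_sub'
    (logAvg N (fun n => expTwoPi (((bigOmega n : ℝ) + l) / (2 * √l))))
    (logAvg N (fun n => expTwoPi √(bigOmega n : ℝ)))
  linarith

theorem not_udMod1_of_fract_eq_zero {x : ℕ → ℝ} (hx : ∀ n, Int.fract (x n) = 0) : ¬udMod1 x := by
  intro h
  have := h (1 / 2) 1 (by norm_num) (by norm_num) le_rfl
  simp only [hx] at this
  norm_num at this

end PowersOfOmega

/-- for `c > 0`, the sequence `(Ω(n)^c)` is uniformly distributed mod 1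
iff `c > 1/2` and `c` is not an integer. -/
theorem stmt5 (c : ℝ) (hc : 0 < c) :
    udMod1 (fun n => (bigOmega n : ℝ) ^ c) ↔
      (1 / 2 < c ∧ ¬∃ m : ℤ, c = (m : ℝ)) := by
  constructor
  · intro h
    have hlog : Tendsto (fun N => logAvg N (fun n => expTwoPi ((bigOmega n : ℝ) ^ c)))
        atTop (nhds 0) := by
      have := (tendsto_expTwoPi_of_udMod1 h).sub (tendsto_average_sub_logAvg_self
        (f := fun k => expTwoPi ((k : ℝ) ^ c)) fun k => (norm_expTwoPi _).le)
      simpa using this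
    refine ⟨?_, ?_⟩
    · by_contra! hc2
      rcases hc2.lt_or_eq with hlt | rfl
      · exact not_tendsto_logAvg_expTwoPi_rpow_of_lt hc hlt hlog
      · simp only [← Real.sqrt_eq_rpow] at hlog
        exact not_tendsto_logAvg_expTwoPi_sqrt hlog
    · rintro ⟨m, rfl⟩
      lift m to ℕ using by exact_mod_cast hc.le
      refine not_udMod1_of_fract_eq_zero (fun n => ?_) h
      simp only [Int.cast_natCast, Real.rpow_natCast]
      exact_mod_cast Int.fract_natCast (bigOmega n ^ m)
  · rintro ⟨hc2, hInt⟩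
    refine udMod1_of_tendsto_expTwoPi fun k hk => ?_
    have := (tendsto_average_sub_logAvg_self
      (f := fun j => expTwoPi (k * (j : ℝ) ^ c)) fun j => (norm_expTwoPi _).le).add
      (tendsto_logAvg_expTwoPi_rpow hc2 hInt (Int.cast_ne_zero.2 hk))
    simpa using this
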